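/- Near-CMC existence (Theorem 3.3, existence part): Suppose |t − γ| > 2 and that η ≠ 0 or μ ≠ 0. Then there exist d > 0 and a solution ψ of the model Lichnerowicz equation L_d (with parameters t, γ, η, μ) satisfying ψ(0) = 1. -/

import Mathlib

open Real Filter

/-- The 2π-periodic function equal to −1 on (−π,0) and 1 on (0,π). -/
noncomputable def lam (x : ℝ) : ℝ := if 0 < Real.sin x then 1 else -1

/-- The critical exponent q = 2n/(n−2). -/
noncomputable def qex (n : ℕ) : ℝ := 2 * n / ((n : ℝ) - 2)

/-- The coupling constant κ = (n−1)/n. -/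
noncomputable def kap (n : ℕ) : ℝ := ((n : ℝ) - 1) / n

/-- A solution of the model Lichnerowicz equation `L_d` with parameters t, γ, η, μ:
a 2π-periodic, positive, C¹ function, twice differentiable off the multiples of π,
satisfying the equation there. -/
def IsModelSolution (n : ℕ) (t γ η μ d : ℝ) (ψ : ℝ → ℝ) : Prop :=
  (∀ x, ψ (x + 2 * Real.pi) = ψ x) ∧
  (∀ x, 0 < ψ x) ∧
  ContDiff ℝ 1 ψ ∧
  ∀ x : ℝ, (∀ k : ℤ, x ≠ (k : ℝ) * Real.pi) →
    DifferentiableAt ℝ (deriv ψ) x ∧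
    -2 * kap n * qex n * d ^ (-(qex n - 2)) * deriv (deriv ψ) x
      - 2 * η ^ 2 * d ^ (-(2 * qex n)) * ψ x ^ (-qex n - 1)
      - kap n * (μ * d ^ (-qex n) + γ + lam x) ^ 2 * ψ x ^ (-qex n - 1)
      + kap n * (t + lam x) ^ 2 * ψ x ^ (qex n - 1) = 0

section Existence

open Set MeasureTheory Topology

/-- The exponentially weighted forward average `∫₀^∞ e^{-ky} h(x+y) dy`. -/
noncomputable def forwardLaplace (k : ℝ) (h : ℝ → ℝ) (x : ℝ) : ℝ :=
  ∫ y in Ioi 0, Real.exp (-k * y) * h (x + y)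

/-- The inverse of `k² - ∂²` acting on bounded functions on the line. -/
noncomputable def bddResolvent (k : ℝ) (h : ℝ → ℝ) (x : ℝ) : ℝ :=
  (forwardLaplace k h x + forwardLaplace k (fun z => h (-z)) (-x)) / (2 * k)

/-- The derivative of `bddResolvent k h`. -/
noncomputable def bddResolventDeriv (k : ℝ) (h : ℝ → ℝ) (x : ℝ) : ℝ :=
  (forwardLaplace k h x - forwardLaplace k (fun z => h (-z)) (-x)) / 2

section Resolvent

variable {k : ℝ} {h : ℝ → ℝ} {C : ℝ}

theorem integrableOn_exp_mul_bounded (hk : 0 < k) (hm : Measurable h) (hC : ∀ x, |h x| ≤ C)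
    (a : ℝ) : IntegrableOn (fun y => Real.exp (-k * y) * h y) (Ioi a) := by
  refine (exp_neg_integrableOn_Ioi a hk).mul_bdd (c := C) hm.aestronglyMeasurable ?_
  exact Eventually.of_forall fun x => by simpa using hC x

theorem integrableOn_forwardLaplace (hk : 0 < k) (hm : Measurable h) (hC : ∀ x, |h x| ≤ C)
    (x : ℝ) : IntegrableOn (fun y => Real.exp (-k * y) * h (x + y)) (Ioi 0) :=
  integrableOn_exp_mul_bounded hk (h := fun y => h (x + y)) (by fun_prop) (fun y => hC _) 0

theorem forwardLaplace_mono {h' : ℝ → ℝ} {C' : ℝ} (hk : 0 < k) (hm : Measurable h)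
    (hC : ∀ x, |h x| ≤ C) (hm' : Measurable h') (hC' : ∀ x, |h' x| ≤ C') (hle : ∀ x, h x ≤ h' x)
    (x : ℝ) : forwardLaplace k h x ≤ forwardLaplace k h' x :=
  integral_mono (integrableOn_forwardLaplace hk hm hC x)
    (integrableOn_forwardLaplace hk hm' hC' x)
    fun _ => mul_le_mul_of_nonneg_left (hle _) (Real.exp_pos _).le

theorem forwardLaplace_const (hk : 0 < k) (c x : ℝ) :
    forwardLaplace k (fun _ => c) x = c / k := by
  have h1 : ∫ y in Ioi (0 : ℝ), Real.exp (-k * y) = 1 / k := by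
    rw [integral_exp_mul_Ioi (by linarith)]
    simp
  rw [forwardLaplace, integral_mul_const, h1]
  ring

theorem forwardLaplace_sub {h' : ℝ → ℝ} {C' : ℝ} (hk : 0 < k) (hm : Measurable h)
    (hC : ∀ x, |h x| ≤ C) (hm' : Measurable h') (hC' : ∀ x, |h' x| ≤ C') (x : ℝ) :
    forwardLaplace k h x - forwardLaplace k h' x = forwardLaplace k (fun z => h z - h' z) x := by
  rw [forwardLaplace, forwardLaplace, forwardLaplace,
    ← integral_sub (integrableOn_forwardLaplace hk hm hC x)
    (integrableOn_forwardLaplace hk hm' hC' x)]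
  simp only [mul_sub]

theorem bddResolvent_mono {h' : ℝ → ℝ} {C' : ℝ} (hk : 0 < k) (hm : Measurable h)
    (hC : ∀ x, |h x| ≤ C) (hm' : Measurable h') (hC' : ∀ x, |h' x| ≤ C') (hle : ∀ x, h x ≤ h' x)
    (x : ℝ) : bddResolvent k h x ≤ bddResolvent k h' x := by
  have h1 := forwardLaplace_mono hk hm hC hm' hC' hle x
  have h2 := forwardLaplace_mono hk (h := fun z => h (-z)) (h' := fun z => h' (-z)) (by fun_prop)
    (fun _ => hC _) (by fun_prop) (fun _ => hC' _) (fun z => hle _) (-x)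
  unfold bddResolvent
  gcongr

theorem bddResolvent_const (hk : 0 < k) (c x : ℝ) : bddResolvent k (fun _ => c) x = c / k ^ 2 := by
  rw [bddResolvent, forwardLaplace_const hk, forwardLaplace_const hk]
  field_simp
  ring

theorem bddResolvent_sub {h' : ℝ → ℝ} {C' : ℝ} (hk : 0 < k) (hm : Measurable h)
    (hC : ∀ x, |h x| ≤ C) (hm' : Measurable h') (hC' : ∀ x, |h' x| ≤ C') (x : ℝ) :
    bddResolvent k h x - bddResolvent k h' x = bddResolvent k (fun z => h z - h' z) x := by
  have h1 := forwardLaplace_sub hk hm hC hm' hC' x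
  have h2 := forwardLaplace_sub hk (h := fun z => h (-z)) (h' := fun z => h' (-z)) (by fun_prop)
    (fun _ => hC _) (by fun_prop) (fun _ => hC' _) (-x)
  rw [bddResolvent, bddResolvent, bddResolvent, ← h1, ← h2]
  ring

theorem abs_bddResolvent_le (hk : 0 < k) (hm : Measurable h) (hC : ∀ x, |h x| ≤ C) (x : ℝ) :
    |bddResolvent k h x| ≤ C / k ^ 2 := by
  rw [abs_le, ← neg_div, ← bddResolvent_const hk C x, ← bddResolvent_const hk (-C) x]
  exact ⟨bddResolvent_mono hk measurable_const (C := |-C|) (fun _ => le_rfl) hm hC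
      (fun z => (abs_le.1 (hC z)).1) x,
    bddResolvent_mono hk hm hC measurable_const (C' := |C|) (fun _ => le_rfl)
      (fun z => (abs_le.1 (hC z)).2) x⟩

theorem bddResolvent_comp_add (k : ℝ) (h : ℝ → ℝ) (T x : ℝ) :
    bddResolvent k (fun z => h (z + T)) x = bddResolvent k h (x + T) := by
  have e1 : ∀ y, h (x + y + T) = h (x + T + y) := fun y => by ring_nf
  have e2 : ∀ y, h (-(-x + y) + T) = h (-(-(x + T) + y)) := fun y => by ring_nf
  simp only [bddResolvent, forwardLaplace, e1, e2]

theorem bddResolvent_comp_sub (k : ℝ) (h : ℝ → ℝ) (T x : ℝ) :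
    bddResolvent k (fun z => h (T - z)) x = bddResolvent k h (T - x) := by
  have e1 : ∀ y, h (T - (x + y)) = h (-(-(T - x) + y)) := fun y => by ring_nf
  have e2 : ∀ y, h (T - -(-x + y)) = h (T - x + y) := fun y => by ring_nf
  simp only [bddResolvent, forwardLaplace, e1, e2]
  rw [add_comm]

theorem forwardLaplace_eq (hk : 0 < k) (hm : Measurable h) (hC : ∀ x, |h x| ≤ C) (x : ℝ) :
    forwardLaplace k h x = Real.exp (k * x) *
      ((∫ z in Ioi 0, Real.exp (-k * z) * h z) - ∫ z in (0 : ℝ)..x, Real.exp (-k * z) * h z) := by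
  have h1 := (measurePreserving_add_left volume x).setIntegral_preimage_emb
    (measurableEmbedding_addLeft x)
    (fun z => Real.exp (k * x) * (Real.exp (-k * z) * h z)) (Ioi x)
  have h2 : (fun y => x + y) ⁻¹' Ioi x = Ioi 0 := by ext y; simp
  rw [h2] at h1
  rw [← intervalIntegral.integral_interval_add_Ioi (integrableOn_exp_mul_bounded hk hm hC 0)
    (integrableOn_exp_mul_bounded hk hm hC x), add_sub_cancel_left, ← integral_const_mul, ← h1,
    forwardLaplace]
  congr 1
  ext y
  rw [← mul_assoc, ← Real.exp_add]
  ring_nf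

theorem intervalIntegrable_exp_mul (hm : Measurable h) (hC : ∀ x, |h x| ≤ C)
    (a b : ℝ) : IntervalIntegrable (fun y => Real.exp (-k * y) * h y) volume a b := by
  have h1 : IntervalIntegrable (fun y => Real.exp (-k * y)) volume a b :=
    Continuous.intervalIntegrable (by fun_prop) a b
  exact ⟨h1.1.mul_bdd (c := C) hm.aestronglyMeasurable
      (Eventually.of_forall fun x => by simpa using hC x),
    h1.2.mul_bdd (c := C) hm.aestronglyMeasurable
      (Eventually.of_forall fun x => by simpa using hC x)⟩

theorem continuous_forwardLaplace (hk : 0 < k) (hm : Measurable h) (hC : ∀ x, |h x| ≤ C) :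
    Continuous (forwardLaplace k h) := by
  rw [funext (forwardLaplace_eq hk hm hC)]
  have := intervalIntegral.continuous_primitive
    (fun a b => intervalIntegrable_exp_mul (k := k) hm hC a b) 0
  fun_prop

theorem hasDerivAt_forwardLaplace (hk : 0 < k) (hm : Measurable h) (hC : ∀ x, |h x| ≤ C)
    {x : ℝ} (hx : ContinuousAt h x) :
    HasDerivAt (forwardLaplace k h) (k * forwardLaplace k h x - h x) x := by
  have h1 : HasDerivAt (fun u => ∫ z in (0 : ℝ)..u, Real.exp (-k * z) * h z)
      (Real.exp (-k * x) * h x) x := by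
    refine intervalIntegral.integral_hasDerivAt_right (intervalIntegrable_exp_mul hm hC _ _) ?_ ?_
    · exact Measurable.stronglyMeasurable (by fun_prop) |>.stronglyMeasurableAtFilter
    · fun_prop
  have h2 : HasDerivAt (fun u => Real.exp (k * u)) (Real.exp (k * x) * (k * 1)) x :=
    ((hasDerivAt_id x).const_mul k).exp
  rw [forwardLaplace_eq hk hm hC x]
  rw [funext (forwardLaplace_eq hk hm hC)]
  refine (h2.mul (h1.const_sub _)).congr_deriv ?_
  have h3 : Real.exp (k * x) * Real.exp (-k * x) = 1 := by
    rw [← Real.exp_add]; simp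
  linear_combination -h x * h3

theorem hasDerivAt_forwardLaplace_neg (hk : 0 < k) (hm : Measurable h) (hC : ∀ x, |h x| ≤ C)
    {x : ℝ} (hx : ContinuousAt h x) :
    HasDerivAt (fun x => forwardLaplace k (fun z => h (-z)) (-x))
      (-(k * forwardLaplace k (fun z => h (-z)) (-x) - h x)) x := by
  have h1 : ContinuousAt (fun z => h (-z)) (-x) :=
    ContinuousAt.comp (by simpa using hx) continuousAt_neg
  have h2 := hasDerivAt_forwardLaplace hk (h := fun z => h (-z)) (by fun_prop) (fun _ => hC _) h1
  exact (h2.comp x (hasDerivAt_neg x)).congr_deriv (by simp)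

theorem continuous_bddResolvent (hk : 0 < k) (hm : Measurable h) (hC : ∀ x, |h x| ≤ C) :
    Continuous (bddResolvent k h) := by
  have h1 := continuous_forwardLaplace hk hm hC
  have h2 := continuous_forwardLaplace hk (h := fun z => h (-z)) (by fun_prop) (fun _ => hC _)
  unfold bddResolvent
  fun_prop

theorem continuous_bddResolventDeriv (hk : 0 < k) (hm : Measurable h) (hC : ∀ x, |h x| ≤ C) :
    Continuous (bddResolventDeriv k h) := by
  have h1 := continuous_forwardLaplace hk hm hC
  have h2 := continuous_forwardLaplace hk (h := fun z => h (-z)) (by fun_prop) (fun _ => hC _)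
  unfold bddResolventDeriv
  fun_prop

theorem hasDerivAt_bddResolventDeriv (hk : 0 < k) (hm : Measurable h) (hC : ∀ x, |h x| ≤ C)
    {x : ℝ} (hx : ContinuousAt h x) :
    HasDerivAt (bddResolventDeriv k h) (k ^ 2 * bddResolvent k h x - h x) x := by
  refine (((hasDerivAt_forwardLaplace hk hm hC hx).sub
    (hasDerivAt_forwardLaplace_neg hk hm hC hx)).div_const 2).congr_deriv ?_
  rw [bddResolvent]
  field_simp
  ring

theorem hasDerivAt_bddResolvent_of_continuousAt (hk : 0 < k) (hm : Measurable h)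
    (hC : ∀ x, |h x| ≤ C) {x : ℝ} (hx : ContinuousAt h x) :
    HasDerivAt (bddResolvent k h) (bddResolventDeriv k h x) x := by
  refine (((hasDerivAt_forwardLaplace hk hm hC hx).add
    (hasDerivAt_forwardLaplace_neg hk hm hC hx)).div_const (2 * k)).congr_deriv ?_
  rw [bddResolventDeriv]
  field_simp
  ring

theorem hasDerivAt_bddResolvent (hk : 0 < k) (hm : Measurable h)
    (hC : ∀ x, |h x| ≤ C) (hcount : {x | ¬ ContinuousAt h x}.Countable) (x : ℝ) :
    HasDerivAt (bddResolvent k h) (bddResolventDeriv k h x) x := by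
  have hc := continuous_bddResolventDeriv hk hm hC
  have h1 : bddResolvent k h = fun x => bddResolvent k h 0 +
      ∫ z in (0 : ℝ)..x, bddResolventDeriv k h z := by
    ext x
    rw [integral_eq_of_hasDerivAt_off_countable (bddResolvent k h) (bddResolventDeriv k h) hcount
      (continuous_bddResolvent hk hm hC).continuousOn
      (fun y hy => hasDerivAt_bddResolvent_of_continuousAt hk hm hC (not_not.1 hy.2))
      (hc.intervalIntegrable _ _)]
    ring
  rw [h1]
  exact (hc.integral_hasStrictDerivAt 0 x).hasDerivAt.const_add _

theorem forwardLaplace_of_hasDerivAt {v v' v'' : ℝ → ℝ} {C C' C'' : ℝ} (hk : 0 < k)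
    (hv : ∀ x, HasDerivAt v (v' x) x) (hv' : ∀ x, HasDerivAt v' (v'' x) x)
    (hm : Measurable v'')
    (hC : ∀ x, |v x| ≤ C) (hC' : ∀ x, |v' x| ≤ C') (hC'' : ∀ x, |v'' x| ≤ C'') (x : ℝ) :
    forwardLaplace k (fun z => k ^ 2 * v z - v'' z) x = k * v x + v' x := by
  have hvc : Continuous v := continuous_iff_continuousAt.2 fun x => (hv x).continuousAt
  have hd : ∀ y, HasDerivAt (fun y => -(Real.exp (-k * y) * (k * v (x + y) + v' (x + y))))
      (Real.exp (-k * y) * (k ^ 2 * v (x + y) - v'' (x + y))) y := by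
    intro y
    have e1 : HasDerivAt (fun u => Real.exp (-k * u)) (Real.exp (-k * y) * (-k * 1)) y :=
      ((hasDerivAt_id y).const_mul (-k)).exp
    have e2 : HasDerivAt (fun u => v (x + u)) (v' (x + y)) y := (hv (x + y)).comp_const_add x y
    have e3 : HasDerivAt (fun u => v' (x + u)) (v'' (x + y)) y :=
      (hv' (x + y)).comp_const_add x y
    refine ((e1.mul ((e2.const_mul k).add e3)).neg).congr_deriv ?_
    simp only [Pi.add_apply]
    ring
  have hlim : Tendsto (fun y => -(Real.exp (-k * y) * (k * v (x + y) + v' (x + y)))) atTop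
      (𝓝 0) := by
    rw [← neg_zero]
    refine Tendsto.neg ?_
    have e0 : Tendsto (fun y => Real.exp (-k * y)) atTop (𝓝 0) :=
      Real.tendsto_exp_atBot.comp (tendsto_id.const_mul_atTop_of_neg (by linarith))
    refine squeeze_zero_norm (a := fun y => Real.exp (-k * y) * (k * C + C')) (fun y => ?_) ?_
    · rw [norm_mul, Real.norm_eq_abs, Real.norm_eq_abs, Real.abs_exp]
      gcongr
      refine (abs_add_le _ _).trans (add_le_add ?_ (hC' _))
      rw [abs_mul, abs_of_pos hk]
      gcongr
      exact hC _
    · simpa using e0.mul_const (k * C + C')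
  rw [forwardLaplace, integral_Ioi_of_hasDerivAt_of_tendsto (hd 0).continuousAt.continuousWithinAt
    (fun y _ => hd y) ?_ hlim]
  · simp
  · refine integrableOn_forwardLaplace (h := fun z => k ^ 2 * v z - v'' z) (C := k ^ 2 * C + C'') hk
      (by fun_prop) (fun z => ?_) x
    refine (abs_sub _ _).trans (add_le_add ?_ (hC'' _))
    rw [abs_mul, abs_of_pos (pow_pos hk 2)]
    gcongr
    exact hC _

theorem bddResolvent_of_hasDerivAt {v v' v'' : ℝ → ℝ} {C C' C'' : ℝ} (hk : 0 < k)
    (hv : ∀ x, HasDerivAt v (v' x) x) (hv' : ∀ x, HasDerivAt v' (v'' x) x)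
    (hm : Measurable v'')
    (hC : ∀ x, |v x| ≤ C) (hC' : ∀ x, |v' x| ≤ C') (hC'' : ∀ x, |v'' x| ≤ C'') (x : ℝ) :
    bddResolvent k (fun z => k ^ 2 * v z - v'' z) x = v x := by
  have h1 := forwardLaplace_of_hasDerivAt hk hv hv' hm hC hC' hC'' x
  have h2 := forwardLaplace_of_hasDerivAt hk (v := fun x => v (-x)) (v' := fun x => -v' (-x))
    (v'' := fun x => v'' (-x)) (C := C) (C' := C') (C'' := C'')
    (fun x => ((hv (-x)).comp x (hasDerivAt_neg x)).congr_deriv (by simp))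
    (fun x => (((hv' (-x)).comp x (hasDerivAt_neg x)).neg).congr_deriv (by simp))
    (by fun_prop) (fun x => hC _) (fun x => by simpa using hC' _) (fun x => hC'' _) (-x)
  rw [bddResolvent, h1, h2, neg_neg]
  field_simp
  ring

end Resolvent

/-- `f` is nondecreasing and Lipschitz with constant `L`. -/
def IsMonoLip (L : ℝ) (f : ℝ → ℝ) : Prop :=
  ∀ u v, u ≤ v → 0 ≤ f v - f u ∧ f v - f u ≤ L * (v - u)

/-- The nonlinearity equal to `fp (u x)` where `sin x > 0` and to `fm (u x)` elsewhere. -/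
noncomputable def stepComp (fp fm u : ℝ → ℝ) (x : ℝ) : ℝ :=
  if 0 < Real.sin x then fp (u x) else fm (u x)

/-- `u` is a bounded continuous fixed point of `u ↦ (k² - ∂²)⁻¹ (stepComp fp fm u)`. -/
structure IsStepFixed (k : ℝ) (fp fm u : ℝ → ℝ) : Prop where
  continuous : Continuous u
  bounded : ∃ C, ∀ x, |u x| ≤ C
  eq : ∀ x, u x = bddResolvent k (stepComp fp fm u) x

section FixedPoint

variable {k L : ℝ} {f fp fm gp gm u v : ℝ → ℝ}

theorem IsMonoLip.abs_sub_le (hf : IsMonoLip L f) (x y : ℝ) : |f x - f y| ≤ L * |x - y| := by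
  rcases le_total x y with h | h
  · rw [abs_sub_comm, abs_sub_comm x, abs_of_nonneg (hf x y h).1, abs_of_nonneg (sub_nonneg.2 h)]
    exact (hf x y h).2
  · rw [abs_of_nonneg (hf y x h).1, abs_of_nonneg (sub_nonneg.2 h)]
    exact (hf y x h).2

theorem IsMonoLip.sub_le (hL : 0 ≤ L) (hf : IsMonoLip L f) {x y B : ℝ} (hB : 0 ≤ B)
    (h : x - y ≤ B) : f x - f y ≤ L * B := by
  rcases le_total x y with h' | h'
  · linarith [(hf x y h').1, mul_nonneg hL hB]
  · exact (hf y x h').2.trans (mul_le_mul_of_nonneg_left h hL)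

theorem IsMonoLip.continuous (hf : IsMonoLip L f) : Continuous f := by
  have : LipschitzWith (Real.toNNReal L) f := LipschitzWith.of_dist_le_mul fun x y => by
    rw [Real.dist_eq, Real.dist_eq]
    exact (hf.abs_sub_le x y).trans
      (mul_le_mul_of_nonneg_right (Real.le_coe_toNNReal L) (abs_nonneg _))
  exact this.continuous

theorem measurable_stepComp (hp : Continuous fp) (hm : Continuous fm) (hu : Continuous u) :
    Measurable (stepComp fp fm u) := by
  refine Measurable.ite ?_ (hp.comp hu).measurable (hm.comp hu).measurable
  exact measurableSet_lt measurable_const Real.measurable_sin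

theorem exists_abs_stepComp_le (hp : IsMonoLip L fp) (hm : IsMonoLip L fm) (hL : 0 ≤ L)
    (hu : ∃ C, ∀ x, |u x| ≤ C) : ∃ C, ∀ x, |stepComp fp fm u x| ≤ C := by
  obtain ⟨C, hC⟩ := hu
  have key : ∀ f, IsMonoLip L f → ∀ x, |f (u x)| ≤ |f 0| + L * C := fun f hf x => by
    have h1 := hf.abs_sub_le (u x) 0
    have h2 := abs_sub_abs_le_abs_sub (f (u x)) (f 0)
    have h3 := mul_le_mul_of_nonneg_left (hC x) hL
    rw [sub_zero] at h1
    linarith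
  refine ⟨max (|fp 0| + L * C) (|fm 0| + L * C), fun x => ?_⟩
  unfold stepComp
  split_ifs
  · exact (key fp hp x).trans (le_max_left _ _)
  · exact (key fm hm x).trans (le_max_right _ _)

theorem continuousAt_stepComp (hp : Continuous fp) (hm : Continuous fm) (hu : Continuous u)
    {x : ℝ} (hx : Real.sin x ≠ 0) : ContinuousAt (stepComp fp fm u) x := by
  rcases hx.lt_or_gt with h | h
  · refine (hm.comp hu).continuousAt.congr ?_
    filter_upwards [Real.continuous_sin.continuousAt.eventually_lt_const h] with y hy
    simp [stepComp, hy.not_gt]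
  · refine (hp.comp hu).continuousAt.congr ?_
    filter_upwards [Real.continuous_sin.continuousAt.eventually_const_lt h] with y hy
    simp [stepComp, hy]

theorem countable_sin_eq_zero : {x : ℝ | Real.sin x = 0}.Countable := by
  refine (countable_range fun n : ℤ => (n : ℝ) * π).mono fun x hx => ?_
  obtain ⟨n, hn⟩ := Real.sin_eq_zero_iff.1 hx
  exact ⟨n, hn⟩

theorem sub_le_of_sub_fixed (hk : 0 < k) (hL : 0 ≤ L) (hLk : L < k ^ 2) {ε : ℝ} (hε : 0 ≤ ε)
    (hfp : IsMonoLip L fp) (hfm : IsMonoLip L fm) (hgp : IsMonoLip L gp) (hgm : IsMonoLip L gm)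
    (hpε : ∀ x, fp x ≤ gp x + ε) (hmε : ∀ x, fm x ≤ gm x + ε)
    (hvc : Continuous v) (hvb : ∃ C, ∀ x, |v x| ≤ C)
    (huc : Continuous u) (hub : ∃ C, ∀ x, |u x| ≤ C)
    (hv : ∀ x, v x ≤ bddResolvent k (stepComp fp fm v) x)
    (hu : ∀ x, bddResolvent k (stepComp gp gm u) x ≤ u x) (x : ℝ) :
    v x - u x ≤ ε / (k ^ 2 - L) := by
  obtain ⟨A, hA⟩ := exists_abs_stepComp_le hfp hfm hL hvb
  obtain ⟨A', hA'⟩ := exists_abs_stepComp_le hgp hgm hL hub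
  obtain ⟨C, hC⟩ := hvb
  obtain ⟨C', hC'⟩ := hub
  have hbdd : BddAbove (range fun x => max (v x - u x) 0) := by
    refine ⟨max (C + C') 0, ?_⟩
    rintro _ ⟨y, rfl⟩
    refine max_le_max ?_ le_rfl
    linarith [(abs_le.1 (hC y)).2, (abs_le.1 (hC' y)).1]
  set B := ⨆ x, max (v x - u x) 0 with hB
  have hle : ∀ y, max (v y - u y) 0 ≤ B := fun y => le_ciSup hbdd y
  have hB0 : 0 ≤ B := (le_max_right _ _).trans (hle 0)
  have hpt : ∀ y, stepComp fp fm v y - stepComp gp gm u y ≤ L * B + ε := fun y => by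
    have hy := (le_max_left _ _).trans (hle y)
    unfold stepComp
    split_ifs
    · linarith [hfp.sub_le hL hB0 hy, hpε (u y)]
    · linarith [hfm.sub_le hL hB0 hy, hmε (u y)]
  have hmv := measurable_stepComp hfp.continuous hfm.continuous hvc
  have hmu := measurable_stepComp hgp.continuous hgm.continuous huc
  have hk2 : 0 < k ^ 2 := by positivity
  have hstep : ∀ y, v y - u y ≤ (L * B + ε) / k ^ 2 := fun y => by
    have h1 := bddResolvent_sub hk hmv hA hmu hA' y
    have h2 := bddResolvent_mono hk (hmv.sub hmu) (C := A + A')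
      (fun z => (abs_sub _ _).trans (add_le_add (hA z) (hA' z)))
      (measurable_const (a := L * B + ε)) (fun _ => le_rfl) hpt y
    rw [bddResolvent_const hk] at h2
    linarith [hv y, hu y, h2.trans' h1.le]
  have hBB : B ≤ (L * B + ε) / k ^ 2 := ciSup_le fun y => max_le (hstep y) (by positivity)
  rw [le_div_iff₀ hk2] at hBB
  refine ((le_max_left _ _).trans (hle x)).trans ?_
  rw [le_div_iff₀ (by linarith)]
  linarith

theorem exists_isStepFixed (hk : 0 < k) (hL : 0 ≤ L) (hLk : L < k ^ 2)
    (hp : IsMonoLip L fp) (hm : IsMonoLip L fm) : ∃ u, IsStepFixed k fp fm u := by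
  have hmeas : ∀ u : BoundedContinuousFunction ℝ ℝ, Measurable (stepComp fp fm u) := fun u =>
    measurable_stepComp hp.continuous hm.continuous u.continuous
  have hbd : ∀ u : BoundedContinuousFunction ℝ ℝ, ∃ C, ∀ x, |stepComp fp fm u x| ≤ C := fun u =>
    exists_abs_stepComp_le hp hm hL ⟨‖u‖, fun x => u.norm_coe_le_norm x⟩
  choose C hC using hbd
  let T : BoundedContinuousFunction ℝ ℝ → BoundedContinuousFunction ℝ ℝ := fun u =>
    BoundedContinuousFunction.ofNormedAddCommGroup (bddResolvent k (stepComp fp fm u))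
      (continuous_bddResolvent hk (hmeas u) (hC u)) (C u / k ^ 2)
      (abs_bddResolvent_le hk (hmeas u) (hC u))
  have hk2 : 0 < k ^ 2 := by positivity
  have hT : ContractingWith (Real.toNNReal (L / k ^ 2)) T := by
    refine ⟨?_, LipschitzWith.of_dist_le_mul fun u v => ?_⟩
    · exact Real.toNNReal_lt_one.2 ((div_lt_one hk2).2 hLk)
    · have hr : 0 ≤ L / k ^ 2 * dist u v := by positivity
      rw [Real.coe_toNNReal _ (by positivity)]
      refine (BoundedContinuousFunction.dist_le hr).2 fun x => ?_
      have h1 := bddResolvent_sub hk (hmeas u) (hC u) (hmeas v) (hC v) x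
      have h2 := abs_bddResolvent_le hk ((hmeas u).sub (hmeas v)) (C := L * dist u v)
        (fun z => ?_) x
      · rw [Real.dist_eq]
        refine (congrArg abs h1).trans_le (h2.trans_eq ?_)
        ring
      · have h3 : |u z - v z| ≤ dist u v := u.dist_coe_le_dist z
        have h4 := mul_le_mul_of_nonneg_left h3 hL
        simp only [Pi.sub_apply, stepComp]
        split_ifs
        · exact (hp.abs_sub_le _ _).trans h4
        · exact (hm.abs_sub_le _ _).trans h4
  let u := ContractingWith.fixedPoint T hT
  have hu : T u = u := hT.fixedPoint_isFixedPt
  exact ⟨u, u.continuous, ⟨‖u‖, fun x => u.norm_coe_le_norm x⟩,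
    fun x => (DFunLike.congr_fun hu x).symm⟩

theorem IsStepFixed.unique (hk : 0 < k) (hL : 0 ≤ L) (hLk : L < k ^ 2)
    (hp : IsMonoLip L fp) (hm : IsMonoLip L fm)
    (hu : IsStepFixed k fp fm u) (hv : IsStepFixed k fp fm v) (x : ℝ) : u x = v x := by
  have key : ∀ u v, IsStepFixed k fp fm u → IsStepFixed k fp fm v → u x - v x ≤ 0 :=
    fun u v hu hv => by
      simpa using sub_le_of_sub_fixed hk hL hLk le_rfl hp hm hp hm (by simp) (by simp)
        hu.continuous hu.bounded hv.continuous hv.bounded (fun x => (hu.eq x).le)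
        (fun x => (hv.eq x).ge) x
  linarith [key u v hu hv, key v u hv hu]

theorem IsStepFixed.periodic (hk : 0 < k) (hL : 0 ≤ L) (hLk : L < k ^ 2)
    (hp : IsMonoLip L fp) (hm : IsMonoLip L fm) (hu : IsStepFixed k fp fm u) (x : ℝ) :
    u (x + 2 * π) = u x := by
  obtain ⟨C, hC⟩ := hu.bounded
  have h1 : IsStepFixed k fp fm fun x => u (x + 2 * π) := by
    refine ⟨hu.continuous.comp (by fun_prop), ⟨C, fun _ => hC _⟩, fun x => ?_⟩
    rw [hu.eq, ← bddResolvent_comp_add]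
    congr 1
    ext z
    simp only [stepComp, Real.sin_add_two_pi]
  exact h1.unique hk hL hLk hp hm hu x

theorem IsStepFixed.reflect (hk : 0 < k) (hL : 0 ≤ L) (hLk : L < k ^ 2)
    (hp : IsMonoLip L fp) (hm : IsMonoLip L fm) (hu : IsStepFixed k fp fm u) (x : ℝ) :
    u (π - x) = u x := by
  obtain ⟨C, hC⟩ := hu.bounded
  have h1 : IsStepFixed k fp fm fun x => u (π - x) := by
    refine ⟨hu.continuous.comp (by fun_prop), ⟨C, fun _ => hC _⟩, fun x => ?_⟩
    rw [hu.eq, ← bddResolvent_comp_sub]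
    congr 1
    ext z
    simp only [stepComp, Real.sin_pi_sub]
  exact h1.unique hk hL hLk hp hm hu x

theorem IsStepFixed.exists_hasDerivAt (hk : 0 < k) (hL : 0 ≤ L)
    (hp : IsMonoLip L fp) (hm : IsMonoLip L fm) (hu : IsStepFixed k fp fm u) :
    ∃ u' : ℝ → ℝ, Continuous u' ∧ (∀ x, HasDerivAt u (u' x) x) ∧
      ∀ x, Real.sin x ≠ 0 → HasDerivAt u' (k ^ 2 * u x - stepComp fp fm u x) x := by
  have hmeas := measurable_stepComp hp.continuous hm.continuous hu.continuous
  obtain ⟨C, hC⟩ := exists_abs_stepComp_le hp hm hL hu.bounded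
  refine ⟨bddResolventDeriv k (stepComp fp fm u), continuous_bddResolventDeriv hk hmeas hC,
    fun x => ?_, fun x hx => ?_⟩
  · have h := hasDerivAt_bddResolvent hk hmeas hC
      (countable_sin_eq_zero.mono fun y hy => ?_) x
    · rwa [← funext hu.eq] at h
    by_contra h
    exact hy (continuousAt_stepComp hp.continuous hm.continuous hu.continuous h)
  · rw [hu.eq x]
    exact hasDerivAt_bddResolventDeriv hk hmeas hC
      (continuousAt_stepComp hp.continuous hm.continuous hu.continuous hx)

end FixedPoint

section Barriers

variable {k L : ℝ} {fp fm gp gm u v : ℝ → ℝ}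

theorem IsStepFixed.ge_of_hasDerivAt {v' v'' : ℝ → ℝ} {C C' C'' : ℝ} (hk : 0 < k) (hL : 0 ≤ L)
    (hLk : L < k ^ 2) (hp : IsMonoLip L fp) (hm : IsMonoLip L fm) (hu : IsStepFixed k fp fm u)
    (hv : ∀ x, HasDerivAt v (v' x) x) (hv' : ∀ x, HasDerivAt v' (v'' x) x)
    (hmeas : Measurable v'')
    (hC : ∀ x, |v x| ≤ C) (hC' : ∀ x, |v' x| ≤ C') (hC'' : ∀ x, |v'' x| ≤ C'')
    (hle : ∀ x, k ^ 2 * v x - v'' x ≤ stepComp fp fm v x) (x : ℝ) : v x ≤ u x := by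
  have hvc : Continuous v := continuous_iff_continuousAt.2 fun x => (hv x).continuousAt
  obtain ⟨A, hA⟩ := exists_abs_stepComp_le hp hm hL ⟨C, hC⟩
  have hsub : ∀ x, v x ≤ bddResolvent k (stepComp fp fm v) x := fun x => by
    refine (bddResolvent_of_hasDerivAt hk hv hv' hmeas hC hC' hC'' x).ge.trans ?_
    refine bddResolvent_mono hk (by fun_prop) (C := k ^ 2 * C + C'') (fun z => ?_)
      (measurable_stepComp hp.continuous hm.continuous hvc) hA hle x
    refine (abs_sub _ _).trans (add_le_add ?_ (hC'' z))
    rw [abs_mul, abs_of_pos (pow_pos hk 2)]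
    exact mul_le_mul_of_nonneg_left (hC z) (by positivity)
  have h1 : v x - u x ≤ 0 := by
    simpa using sub_le_of_sub_fixed hk hL hLk le_rfl hp hm hp hm (by simp) (by simp)
      hvc ⟨C, hC⟩ hu.continuous hu.bounded hsub (fun x => (hu.eq x).ge) x
  linarith

theorem IsStepFixed.const_le (hk : 0 < k) (hL : 0 ≤ L) (hLk : L < k ^ 2) (hp : IsMonoLip L fp)
    (hm : IsMonoLip L fm) (hu : IsStepFixed k fp fm u) {e : ℝ} (hpe : k ^ 2 * e ≤ fp e)
    (hme : k ^ 2 * e ≤ fm e) (x : ℝ) : e ≤ u x := by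
  refine hu.ge_of_hasDerivAt hk hL hLk hp hm (v := fun _ => e) (v' := fun _ => 0)
    (v'' := fun _ => 0) (C := |e|) (C' := 0) (C'' := 0) (fun x => hasDerivAt_const x e)
    (fun x => hasDerivAt_const x 0) measurable_const (by simp) (by simp) (by simp) (fun x => ?_) x
  unfold stepComp
  split_ifs <;> linarith

theorem IsStepFixed.le_const (hk : 0 < k) (hL : 0 ≤ L) (hLk : L < k ^ 2) (hp : IsMonoLip L fp)
    (hm : IsMonoLip L fm) (hu : IsStepFixed k fp fm u) {e : ℝ} (hpe : fp e ≤ k ^ 2 * e)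
    (hme : fm e ≤ k ^ 2 * e) (x : ℝ) : u x ≤ e := by
  have hb : ∃ C, ∀ x : ℝ, |(fun _ => e) x| ≤ C := ⟨|e|, fun _ => le_rfl⟩
  obtain ⟨A, hA⟩ := exists_abs_stepComp_le hp hm hL hb
  have hsup : ∀ x, bddResolvent k (stepComp fp fm fun _ => e) x ≤ e := fun x => by
    have h2 := bddResolvent_mono hk (measurable_stepComp hp.continuous hm.continuous
      (continuous_const (y := e))) hA (measurable_const (a := k ^ 2 * e)) (fun _ => le_rfl)
      (fun x => ?_) x
    · rwa [bddResolvent_const hk, mul_div_cancel_left₀ _ (by positivity)] at h2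
    · unfold stepComp
      split_ifs <;> assumption
  have h1 : u x - e ≤ 0 := by
    simpa using sub_le_of_sub_fixed hk hL hLk le_rfl hp hm hp hm (by simp) (by simp)
      hu.continuous hu.bounded continuous_const hb (fun x => (hu.eq x).le) hsup x
  linarith

theorem IsStepFixed.abs_sub_le (hk : 0 < k) (hL : 0 ≤ L) (hLk : L < k ^ 2) (hp : IsMonoLip L fp)
    (hm : IsMonoLip L fm) (hgp : IsMonoLip L gp) (hgm : IsMonoLip L gm)
    (hu : IsStepFixed k fp fm u) (hv : IsStepFixed k gp gm v) {ε : ℝ}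
    (hpε : ∀ x, |fp x - gp x| ≤ ε) (hmε : ∀ x, |fm x - gm x| ≤ ε) (x : ℝ) :
    |u x - v x| ≤ ε / (k ^ 2 - L) := by
  have hε : 0 ≤ ε := (abs_nonneg _).trans (hpε 0)
  have h1 := sub_le_of_sub_fixed hk hL hLk hε hp hm hgp hgm
    (fun x => by linarith [(abs_le.1 (hpε x)).2]) (fun x => by linarith [(abs_le.1 (hmε x)).2])
    hu.continuous hu.bounded hv.continuous hv.bounded (fun x => (hu.eq x).le)
    (fun x => (hv.eq x).ge) x
  have h2 := sub_le_of_sub_fixed hk hL hLk hε hgp hgm hp hm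
    (fun x => by linarith [(abs_le.1 (hpε x)).1]) (fun x => by linarith [(abs_le.1 (hmε x)).1])
    hv.continuous hv.bounded hu.continuous hu.bounded (fun x => (hv.eq x).le)
    (fun x => (hu.eq x).ge) x
  exact abs_le.2 ⟨by linarith, h1⟩

end Barriers

/-- The right-hand side of the Lichnerowicz equation, normalized as `φ'' = powLaw q α c φ`. -/
noncomputable def powLaw (q α c u : ℝ) : ℝ := (α * u ^ (q - 1) - c * u ^ (-q - 1)) / (2 * q)

/-- `powLaw` precomposed with the projection to `[m, M]` and continued with slope `1`. -/
noncomputable def truncLaw (q α c m M u : ℝ) : ℝ :=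
  powLaw q α c (max m (min u M)) + (u - max m (min u M))

section PowLaw

variable {q α c m M : ℝ}

theorem truncLaw_of_mem {u : ℝ} (h1 : m ≤ u) (h2 : u ≤ M) :
    truncLaw q α c m M u = powLaw q α c u := by
  simp [truncLaw, h1, h2]

theorem powLaw_eq (α c : ℝ) {u : ℝ} (hu : 0 < u) :
    powLaw q α c u = u ^ (-q - 1) * (α * u ^ (2 * q) - c) / (2 * q) := by
  have h : u ^ (q - 1) = u ^ (-q - 1) * u ^ (2 * q) := by
    rw [← Real.rpow_add hu]
    ring_nf
  rw [powLaw, h]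
  ring

theorem powLaw_nonpos (hq : 2 < q) {u : ℝ} (hu : 0 < u) (h : α * u ^ (2 * q) ≤ c) :
    powLaw q α c u ≤ 0 := by
  rw [powLaw_eq α c hu]
  exact div_nonpos_of_nonpos_of_nonneg
    (mul_nonpos_of_nonneg_of_nonpos (by positivity) (by linarith)) (by linarith)

theorem powLaw_nonneg (hq : 2 < q) {u : ℝ} (hu : 0 < u) (h : c ≤ α * u ^ (2 * q)) :
    0 ≤ powLaw q α c u := by
  rw [powLaw_eq α c hu]
  exact div_nonneg (mul_nonneg (by positivity) (by linarith)) (by linarith)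

theorem powLaw_anti (hq : 2 < q) {c' : ℝ} (hc : c ≤ c') {u : ℝ} (hu : 0 < u) :
    powLaw q α c' u ≤ powLaw q α c u := by
  unfold powLaw
  gcongr

theorem powLaw_mono (hq : 2 < q) (hα : 0 < α) (hc : 0 ≤ c) {u v : ℝ} (hu : 0 < u)
    (huv : u ≤ v) : powLaw q α c u ≤ powLaw q α c v := by
  have h1 : u ^ (q - 1) ≤ v ^ (q - 1) := Real.rpow_le_rpow hu.le huv (by linarith)
  have h2 : v ^ (-q - 1) ≤ u ^ (-q - 1) :=
    Real.rpow_le_rpow_of_nonpos hu huv (by linarith)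
  unfold powLaw
  gcongr

theorem hasDerivAt_powLaw {u : ℝ} (hu : 0 < u) : HasDerivAt (powLaw q α c)
    ((α * ((q - 1) * u ^ (q - 2)) + c * ((q + 1) * u ^ (-q - 2))) / (2 * q)) u := by
  have h1 := (Real.hasDerivAt_rpow_const (p := q - 1) (Or.inl hu.ne')).const_mul α
  have h2 := (Real.hasDerivAt_rpow_const (p := -q - 1) (Or.inl hu.ne')).const_mul c
  refine ((h1.sub h2).div_const (2 * q)).congr_deriv ?_
  rw [show q - 1 - 1 = q - 2 by ring, show -q - 1 - 1 = -q - 2 by ring]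
  ring

theorem truncLaw_slope (hq : 2 < q) (hα : 0 ≤ α) (hc : 0 ≤ c) (hm : 0 < m) (hmM : m ≤ M) {δ K : ℝ}
    (hδ1 : δ ≤ 1) (hδ : δ ≤ α * ((q - 1) * m ^ (q - 2)) / (2 * q)) (hK1 : 1 ≤ K)
    (hK : (α * ((q - 1) * M ^ (q - 2)) + c * ((q + 1) * m ^ (-q - 2))) / (2 * q) ≤ K)
    {u v : ℝ} (huv : u ≤ v) :
    δ * (v - u) ≤ truncLaw q α c m M v - truncLaw q α c m M u ∧
      truncLaw q α c m M v - truncLaw q α c m M u ≤ K * (v - u) := by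
  have hcont : ContinuousOn (powLaw q α c) (Icc m M) := fun x hx =>
    (hasDerivAt_powLaw (hm.trans_le hx.1)).continuousAt.continuousWithinAt
  have hdiff : DifferentiableOn ℝ (powLaw q α c) (interior (Icc m M)) := fun x hx =>
    (hasDerivAt_powLaw (hm.trans_le (interior_subset hx).1)).differentiableAt.differentiableWithinAt
  have hlow : ∀ x ∈ interior (Icc m M), δ ≤ deriv (powLaw q α c) x := fun x hx => by
    have hx' := interior_subset hx
    have hx0 : 0 < x := hm.trans_le hx'.1
    rw [(hasDerivAt_powLaw hx0).deriv]
    refine hδ.trans ?_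
    have h1 : m ^ (q - 2) ≤ x ^ (q - 2) := Real.rpow_le_rpow hm.le hx'.1 (by linarith)
    have h2 : 0 ≤ c * ((q + 1) * x ^ (-q - 2)) := by positivity
    have h3 : 0 ≤ q - 1 := by linarith
    gcongr
    linarith [mul_le_mul_of_nonneg_left (mul_le_mul_of_nonneg_left h1 h3) hα]
  have hhigh : ∀ x ∈ interior (Icc m M), deriv (powLaw q α c) x ≤ K := fun x hx => by
    have hx' := interior_subset hx
    have hx0 : 0 < x := hm.trans_le hx'.1
    rw [(hasDerivAt_powLaw hx0).deriv]
    refine le_trans ?_ hK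
    have h1 : x ^ (q - 2) ≤ M ^ (q - 2) := Real.rpow_le_rpow hx0.le hx'.2 (by linarith)
    have h2 : x ^ (-q - 2) ≤ m ^ (-q - 2) :=
      Real.rpow_le_rpow_of_nonpos hm hx'.1 (by linarith)
    have h3 : 0 ≤ q - 1 := by linarith
    gcongr
  have hmem : ∀ u, max m (min u M) ∈ Icc m M := fun u =>
    ⟨le_max_left _ _, max_le hmM (min_le_right _ _)⟩
  have hle : max m (min u M) ≤ max m (min v M) := max_le_max le_rfl (min_le_min huv le_rfl)
  have hle' : max m (min v M) - max m (min u M) ≤ v - u := by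
    rcases max_cases m (min v M) with h1 | h1 <;> rcases max_cases m (min u M) with h2 | h2 <;>
    rcases min_cases v M with h3 | h3 <;> rcases min_cases u M with h4 | h4 <;> linarith
  have h1 := (convex_Icc m M).mul_sub_le_image_sub_of_le_deriv hcont hdiff hlow _ (hmem u) _
    (hmem v) hle
  have h2 := (convex_Icc m M).image_sub_le_mul_sub_of_deriv_le hcont hdiff hhigh _ (hmem u) _
    (hmem v) hle
  unfold truncLaw
  constructor
  · nlinarith
  · nlinarith

theorem isMonoLip_truncLaw (hq : 2 < q) (hα : 0 ≤ α) (hc : 0 ≤ c) (hm : 0 < m) (hmM : m ≤ M)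
    {δ K : ℝ}
    (hδ1 : δ ≤ 1) (hδ : δ ≤ α * ((q - 1) * m ^ (q - 2)) / (2 * q)) (hK1 : 1 ≤ K)
    (hK : (α * ((q - 1) * M ^ (q - 2)) + c * ((q + 1) * m ^ (-q - 2))) / (2 * q) ≤ K) :
    IsMonoLip (K - δ) fun u => K * u - truncLaw q α c m M u := fun u v huv => by
  have := truncLaw_slope hq hα hc hm hmM hδ1 hδ hK1 hK huv
  constructor <;> linarith [this.1, this.2]

theorem abs_truncLaw_sub_le (hq : 2 < q) (hm : 0 < m) (c c' u : ℝ) :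
    |truncLaw q α c m M u - truncLaw q α c' m M u| ≤ |c - c'| * m ^ (-q - 1) := by
  have h0 : 0 < max m (min u M) := hm.trans_le (le_max_left _ _)
  have h1 : (max m (min u M)) ^ (-q - 1) ≤ m ^ (-q - 1) :=
    Real.rpow_le_rpow_of_nonpos hm (le_max_left _ _) (by linarith)
  have h2 : truncLaw q α c m M u - truncLaw q α c' m M u =
      -((c - c') * (max m (min u M)) ^ (-q - 1) / (2 * q)) := by
    simp only [truncLaw, powLaw]
    ring
  rw [h2, abs_neg, abs_div, abs_mul, abs_of_pos (Real.rpow_pos_of_pos h0 _),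
    abs_of_pos (by linarith : 0 < 2 * q)]
  refine (div_le_self (by positivity) (by linarith)).trans ?_
  gcongr

end PowLaw

/-- A positive `2π`-periodic `C¹` function, symmetric about `π/2`, which solves
`φ'' = powLaw q αp cp φ` where `sin x > 0` and `φ'' = powLaw q αm cm φ` where `sin x < 0`. -/
structure IsPowSol (q αp αm cp cm : ℝ) (φ φ' : ℝ → ℝ) : Prop where
  pos : ∀ x, 0 < φ x
  periodic : ∀ x, φ (x + 2 * π) = φ x
  reflect : ∀ x, φ (π - x) = φ x
  continuous_deriv : Continuous φ'
  hasDerivAt : ∀ x, HasDerivAt φ (φ' x) x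
  hasDerivAt_deriv : ∀ x, Real.sin x ≠ 0 → HasDerivAt φ'
    (if 0 < Real.sin x then powLaw q αp cp (φ x) else powLaw q αm cm (φ x)) x

/-- Truncation parameters adapted to all coefficients `c ≤ cmax` of which at least one of the two
is at least `c₀`. -/
structure IsTruncation (q αp αm c₀ cmax m M δ k : ℝ) : Prop where
  two_lt : 2 < q
  αp_pos : 0 < αp
  αm_pos : 0 < αm
  c₀_pos : 0 < c₀
  m_pos : 0 < m
  k_pos : 0 < k
  δ_pos : 0 < δ
  m_le : 4 * m ≤ M
  low_p : powLaw q αp 0 (4 * m) ≤ 4 * m / 7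
  low_m : powLaw q αm 0 (4 * m) ≤ 4 * m / 7
  low_p' : powLaw q αp c₀ (4 * m) ≤ -(12 * m / 7)
  low_m' : powLaw q αm c₀ (4 * m) ≤ -(12 * m / 7)
  high_p : cmax ≤ αp * M ^ (2 * q)
  high_m : cmax ≤ αm * M ^ (2 * q)
  δ_le_one : δ ≤ 1
  δ_le_p : δ ≤ αp * ((q - 1) * m ^ (q - 2)) / (2 * q)
  δ_le_m : δ ≤ αm * ((q - 1) * m ^ (q - 2)) / (2 * q)
  one_le : 1 ≤ k ^ 2
  le_p : (αp * ((q - 1) * M ^ (q - 2)) + cmax * ((q + 1) * m ^ (-q - 2))) / (2 * q) ≤ k ^ 2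
  le_m : (αm * ((q - 1) * M ^ (q - 2)) + cmax * ((q + 1) * m ^ (-q - 2))) / (2 * q) ≤ k ^ 2

section Truncation

variable {q αp αm c₀ cmax m M δ k : ℝ}

theorem eventually_powLaw_zero_le (hq : 2 < q) (α : ℝ) :
    ∀ᶠ m in 𝓝[>] (0 : ℝ), powLaw q α 0 (4 * m) ≤ 4 * m / 7 := by
  have h1 : Tendsto (fun m : ℝ => α * (4 * m) ^ (q - 2) / (2 * q)) (𝓝[>] 0) (𝓝 0) := by
    have : ContinuousAt (fun m : ℝ => α * (4 * m) ^ (q - 2) / (2 * q)) 0 := by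
      have := (Real.continuous_rpow_const (q := q - 2) (by linarith))
      fun_prop
    have h2 := this.tendsto.mono_left (nhdsWithin_le_nhds (s := Ioi 0))
    simpa [Real.zero_rpow (by linarith : q - 2 ≠ 0)] using h2
  filter_upwards [h1.eventually_lt_const (by norm_num : (0 : ℝ) < 1 / 7), self_mem_nhdsWithin]
    with m hm hm0
  have hm0 : 0 < 4 * m := by simpa using hm0
  have h2 : (4 * m) ^ (q - 1) = (4 * m) ^ (q - 2) * (4 * m) := by
    rw [← Real.rpow_add_one hm0.ne']
    ring_nf
  rw [powLaw, h2]
  have := mul_lt_mul_of_pos_right hm hm0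
  calc _ = α * (4 * m) ^ (q - 2) / (2 * q) * (4 * m) := by ring
    _ ≤ _ := by linarith

theorem eventually_powLaw_le_neg (hq : 2 < q) (α : ℝ) (hc : 0 < c₀) :
    ∀ᶠ m in 𝓝[>] (0 : ℝ), powLaw q α c₀ (4 * m) ≤ -(12 * m / 7) := by
  have h1 : Tendsto (fun m : ℝ => α * (4 * m) ^ (2 * q) + q * (4 * m) ^ (q + 2)) (𝓝[>] 0)
      (𝓝 0) := by
    have : ContinuousAt (fun m : ℝ => α * (4 * m) ^ (2 * q) + q * (4 * m) ^ (q + 2)) 0 := by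
      have := (Real.continuous_rpow_const (q := 2 * q) (by linarith))
      have := (Real.continuous_rpow_const (q := q + 2) (by linarith))
      fun_prop
    have h2 := this.tendsto.mono_left (nhdsWithin_le_nhds (s := Ioi 0))
    simpa [Real.zero_rpow (by linarith : 2 * q ≠ 0),
      Real.zero_rpow (by linarith : q + 2 ≠ 0)] using h2
  filter_upwards [h1.eventually_lt_const hc, self_mem_nhdsWithin] with m hm hm0
  have hm0 : 0 < 4 * m := by simpa using hm0
  have h2 : (4 * m) ^ (-q - 1) * (4 * m) ^ (q + 2) = 4 * m := by
    rw [← Real.rpow_add hm0]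
    ring_nf
    rw [Real.rpow_one]
  have h3 : 0 < (4 * m) ^ (-q - 1) := Real.rpow_pos_of_pos hm0 _
  rw [powLaw_eq α c₀ hm0, div_le_iff₀ (by linarith)]
  nlinarith [mul_lt_mul_of_pos_left hm h3, mul_pos (by linarith : 0 < q) hm0]

theorem exists_isTruncation (hq : 2 < q) (hp : 0 < αp) (hm : 0 < αm) (hc₀ : 0 < c₀) (cmax : ℝ)
    {d₀ : ℝ} (hd₀ : 0 < d₀) (d₁ : ℝ) :
    ∃ m M δ k, IsTruncation q αp αm c₀ cmax m M δ k ∧ m ≤ d₀ ∧ d₁ ≤ M := by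
  have hlt : ∀ᶠ m in 𝓝[>] (0 : ℝ), m < d₀ := mem_nhdsWithin_of_mem_nhds (Iio_mem_nhds hd₀)
  have hgt : ∀ᶠ m in 𝓝[>] (0 : ℝ), 0 < m := self_mem_nhdsWithin
  obtain ⟨m, h1, h2, h3, h4, h5, hm0⟩ := ((eventually_powLaw_zero_le hq αp).and
    ((eventually_powLaw_zero_le hq αm).and ((eventually_powLaw_le_neg hq αp hc₀).and
    ((eventually_powLaw_le_neg hq αm hc₀).and (hlt.and hgt))))).exists
  have hinf : ∀ α : ℝ, 0 < α → Tendsto (fun M : ℝ => α * M ^ (2 * q)) atTop atTop := fun α hα =>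
    (tendsto_rpow_atTop (by linarith)).const_mul_atTop hα
  obtain ⟨M, h7, h8, h9, h10⟩ := (((hinf αp hp).eventually_ge_atTop cmax).and
    (((hinf αm hm).eventually_ge_atTop cmax).and
    ((eventually_ge_atTop (4 * m)).and (eventually_ge_atTop d₁)))).exists
  have hq1 : 0 < q - 1 := by linarith
  obtain ⟨k, hk⟩ := ((tendsto_pow_atTop (α := ℝ) two_ne_zero).eventually_ge_atTop
    (max ((αp * ((q - 1) * M ^ (q - 2)) + cmax * ((q + 1) * m ^ (-q - 2))) / (2 * q))
      ((αm * ((q - 1) * M ^ (q - 2)) + cmax * ((q + 1) * m ^ (-q - 2))) / (2 * q)))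
    |>.and (eventually_ge_atTop 1)).exists
  refine ⟨m, M, min 1 (min (αp * ((q - 1) * m ^ (q - 2)) / (2 * q))
    (αm * ((q - 1) * m ^ (q - 2)) / (2 * q))), k, ?_, h5.le, h10⟩
  exact
    { two_lt := hq
      αp_pos := hp
      αm_pos := hm
      c₀_pos := hc₀
      m_pos := hm0
      k_pos := by linarith [hk.2]
      δ_pos := lt_min one_pos (lt_min (by positivity) (by positivity))
      m_le := h9
      low_p := h1
      low_m := h2
      low_p' := h3
      low_m' := h4
      high_p := h7
      high_m := h8
      δ_le_one := min_le_left _ _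
      δ_le_p := (min_le_right _ _).trans (min_le_left _ _)
      δ_le_m := (min_le_right _ _).trans (min_le_right _ _)
      one_le := by nlinarith [hk.2]
      le_p := (le_max_left _ _).trans hk.1
      le_m := (le_max_right _ _).trans hk.1 }

theorem IsTruncation.le (H : IsTruncation q αp αm c₀ cmax m M δ k) : m ≤ M := by
  linarith [H.m_le, H.m_pos]

theorem IsTruncation.isMonoLip_p (H : IsTruncation q αp αm c₀ cmax m M δ k) {c : ℝ} (hc : 0 ≤ c)
    (hc' : c ≤ cmax) : IsMonoLip (k ^ 2 - δ) fun u => k ^ 2 * u - truncLaw q αp c m M u := by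
  have := H.two_lt
  have := H.m_pos
  refine isMonoLip_truncLaw H.two_lt H.αp_pos.le hc H.m_pos H.le H.δ_le_one H.δ_le_p H.one_le
    (le_trans ?_ H.le_p)
  gcongr

theorem IsTruncation.isMonoLip_m (H : IsTruncation q αp αm c₀ cmax m M δ k) {c : ℝ} (hc : 0 ≤ c)
    (hc' : c ≤ cmax) : IsMonoLip (k ^ 2 - δ) fun u => k ^ 2 * u - truncLaw q αm c m M u := by
  have := H.two_lt
  have := H.m_pos
  refine isMonoLip_truncLaw H.two_lt H.αm_pos.le hc H.m_pos H.le H.δ_le_one H.δ_le_m H.one_le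
    (le_trans ?_ H.le_m)
  gcongr

/-- The fixed points of the truncated problem. -/
abbrev IsTruncFixed (q αp αm cp cm m M k : ℝ) (u : ℝ → ℝ) : Prop :=
  IsStepFixed k (fun u => k ^ 2 * u - truncLaw q αp cp m M u)
    (fun u => k ^ 2 * u - truncLaw q αm cm m M u) u

variable {cp cm : ℝ} {u : ℝ → ℝ}

theorem IsTruncation.le_of_isTruncFixed (H : IsTruncation q αp αm c₀ cmax m M δ k)
    (hp : 0 ≤ cp) (hp' : cp ≤ cmax) (hm : 0 ≤ cm) (hm' : cm ≤ cmax)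
    (hu : IsTruncFixed q αp αm cp cm m M k u)
    {e : ℝ} (he : m ≤ e) (hep : cp ≤ αp * e ^ (2 * q)) (hem : cm ≤ αm * e ^ (2 * q))
    (heM : e ≤ M) (x : ℝ) : u x ≤ e := by
  have he0 := H.m_pos.trans_le he
  refine hu.le_const H.k_pos (by linarith [H.one_le, H.δ_le_one]) (by linarith [H.δ_pos])
    (H.isMonoLip_p hp hp') (H.isMonoLip_m hm hm') ?_ ?_ x
  · rw [truncLaw_of_mem he heM]
    linarith [powLaw_nonneg H.two_lt he0 hep]
  · rw [truncLaw_of_mem he heM]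
    linarith [powLaw_nonneg H.two_lt he0 hem]

theorem IsTruncation.ge_of_isTruncFixed (H : IsTruncation q αp αm c₀ cmax m M δ k)
    (hp : 0 ≤ cp) (hp' : cp ≤ cmax) (hm : 0 ≤ cm) (hm' : cm ≤ cmax)
    (hu : IsTruncFixed q αp αm cp cm m M k u)
    {e : ℝ} (he : m ≤ e) (hep : αp * e ^ (2 * q) ≤ cp) (hem : αm * e ^ (2 * q) ≤ cm)
    (x : ℝ) : e ≤ u x := by
  have he0 := H.m_pos.trans_le he
  have h2q : 0 < 2 * q := by linarith [H.two_lt]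
  have heM : e ≤ M := by
    by_contra! h
    have h1 := Real.rpow_lt_rpow (by linarith [H.m_le, H.m_pos]) h h2q
    have h2 := mul_lt_mul_of_pos_left h1 H.αp_pos
    linarith [H.high_p]
  refine hu.const_le H.k_pos (by linarith [H.one_le, H.δ_le_one]) (by linarith [H.δ_pos])
    (H.isMonoLip_p hp hp') (H.isMonoLip_m hm hm') ?_ ?_ x
  · rw [truncLaw_of_mem he heM]
    linarith [powLaw_nonpos H.two_lt he0 hep]
  · rw [truncLaw_of_mem he heM]
    linarith [powLaw_nonpos H.two_lt he0 hem]

theorem IsTruncation.m_le_of_isTruncFixed (H : IsTruncation q αp αm c₀ cmax m M δ k)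
    (hp : 0 ≤ cp) (hp' : cp ≤ cmax) (hm : 0 ≤ cm) (hm' : cm ≤ cmax)
    (hu : IsTruncFixed q αp αm cp cm m M k u) (hc : c₀ ≤ cp ∨ c₀ ≤ cm) (x : ℝ) : m ≤ u x := by
  have hm0 := H.m_pos
  have hq := H.two_lt
  obtain ⟨σ, hσ, hσc⟩ : ∃ σ : ℝ, (σ = 1 ∨ σ = -1) ∧ ((σ = 1 → c₀ ≤ cm) ∧ (σ = -1 → c₀ ≤ cp)) := by
    rcases hc with h | h
    · exact ⟨-1, by norm_num, by norm_num, fun _ => h⟩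
    · exact ⟨1, by norm_num, fun _ => h, by norm_num⟩
  have hσs : ∀ x, |σ * Real.sin x| ≤ 1 := fun x => by
    rcases hσ with rfl | rfl <;> simpa using Real.abs_sin_le_one x
  have hσ' : ∀ x, |σ * Real.cos x| ≤ 1 := fun x => by
    rcases hσ with rfl | rfl <;> simpa using Real.abs_cos_le_one x
  have hsq : ∀ x, (σ * Real.sin x) ^ 2 = Real.sin x ^ 2 := fun x => by
    rcases hσ with rfl | rfl <;> simp
  have hcos2 : ∀ x, Real.cos (2 * x) = 1 - 2 * (σ * Real.sin x) ^ 2 := fun x => by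
    rw [hsq, Real.cos_two_mul, Real.cos_sq']
    ring
  set v : ℝ → ℝ := fun x => m / 7 * (16 - 8 * (σ * Real.sin x) - Real.cos (2 * x)) with hv
  set v' : ℝ → ℝ := fun x => m / 7 * (-8 * (σ * Real.cos x) + 2 * Real.sin (2 * x)) with hv'
  set v'' : ℝ → ℝ := fun x => m / 7 * (8 * (σ * Real.sin x) + 4 * Real.cos (2 * x)) with hv''
  have hm7 : 0 < m / 7 := by linarith
  have hv_low : ∀ x, m ≤ v x := fun x => by
    simp only [hv]
    nlinarith [(abs_le.1 (hσs x)).2, Real.cos_le_one (2 * x)]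
  have hv_high : ∀ x, v x ≤ 4 * m := fun x => by
    simp only [hv]
    nlinarith [(abs_le.1 (hσs x)).1, Real.neg_one_le_cos (2 * x)]
  have d2 : ∀ x, HasDerivAt (fun x : ℝ => 2 * x) 2 x := fun x => by
    simpa using (hasDerivAt_id x).const_mul 2
  have hd : ∀ x, HasDerivAt v (v' x) x := fun x => by
    refine (((((Real.hasDerivAt_sin x).const_mul σ).const_mul 8).const_sub 16).sub
      (d2 x).cos |>.const_mul (m / 7)).congr_deriv ?_
    simp only [hv']
    ring
  have hd' : ∀ x, HasDerivAt v' (v'' x) x := fun x => by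
    refine ((((Real.hasDerivAt_cos x).const_mul σ).const_mul (-8)).add
      ((d2 x).sin.const_mul 2) |>.const_mul (m / 7)).congr_deriv ?_
    simp only [hv'']
    ring
  have hgood : ∀ x, -(12 * m / 7) ≤ v'' x := fun x => by
    simp only [hv'']
    nlinarith [(abs_le.1 (hσs x)).1, Real.neg_one_le_cos (2 * x)]
  have hbad : ∀ x, 0 ≤ σ * Real.sin x → 4 * m / 7 ≤ v'' x := fun x hx => by
    simp only [hv'', hcos2]
    have := (abs_le.1 (hσs x)).2
    nlinarith [mul_nonneg hm7.le (mul_nonneg hx (sub_nonneg.2 this))]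
  have hbadlaw : ∀ α c, 0 < α → 0 ≤ c → powLaw q α 0 (4 * m) ≤ 4 * m / 7 → ∀ x,
      truncLaw q α c m M (v x) ≤ 4 * m / 7 := fun α c hα hc h x => by
    rw [truncLaw_of_mem (hv_low x) ((hv_high x).trans H.m_le)]
    exact ((powLaw_mono hq hα hc (hm0.trans_le (hv_low x)) (hv_high x)).trans
      (powLaw_anti hq hc (by linarith))).trans h
  have hgoodlaw : ∀ α c, 0 < α → c₀ ≤ c → powLaw q α c₀ (4 * m) ≤ -(12 * m / 7) → ∀ x,
      truncLaw q α c m M (v x) ≤ -(12 * m / 7) := fun α c hα hc h x => by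
    rw [truncLaw_of_mem (hv_low x) ((hv_high x).trans H.m_le)]
    exact ((powLaw_mono hq hα (H.c₀_pos.le.trans hc) (hm0.trans_le (hv_low x)) (hv_high x)).trans
      (powLaw_anti hq hc (by linarith))).trans h
  refine (hv_low x).trans (hu.ge_of_hasDerivAt H.k_pos (by linarith [H.one_le, H.δ_le_one])
    (by linarith [H.δ_pos]) (H.isMonoLip_p hp hp') (H.isMonoLip_m hm hm') hd hd'
    (by fun_prop) (C := 4 * m) (C' := m / 7 * 10) (C'' := m / 7 * 12) (fun x => ?_) (fun x => ?_)
    (fun x => ?_) (fun x => ?_) x)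
  · rw [abs_of_pos (hm0.trans_le (hv_low x))]
    exact hv_high x
  · simp only [hv', abs_mul, abs_of_pos hm7]
    gcongr
    rw [abs_le]
    constructor <;> linarith [abs_le.1 (hσ' x), Real.sin_le_one (2 * x),
      Real.neg_one_le_sin (2 * x), (abs_le.1 (hσ' x)).1, (abs_le.1 (hσ' x)).2]
  · simp only [hv'', abs_mul (m / 7), abs_of_pos hm7]
    gcongr
    rw [abs_le]
    constructor <;> linarith [Real.cos_le_one (2 * x),
      Real.neg_one_le_cos (2 * x), (abs_le.1 (hσs x)).1, (abs_le.1 (hσs x)).2]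
  · unfold stepComp
    rcases hσ with rfl | rfl
    · split_ifs with hs
      · linarith [hbadlaw αp cp H.αp_pos hp H.low_p x, hbad x (by linarith)]
      · linarith [hgoodlaw αm cm H.αm_pos (hσc.1 rfl) H.low_m' x, hgood x]
    · split_ifs with hs
      · linarith [hgoodlaw αp cp H.αp_pos (hσc.2 rfl) H.low_p' x, hgood x]
      · linarith [hbadlaw αm cm H.αm_pos hm H.low_m x, hbad x (by linarith)]

theorem IsTruncation.exists_isPowSol (H : IsTruncation q αp αm c₀ cmax m M δ k)
    (hp : 0 ≤ cp) (hp' : cp ≤ cmax) (hm : 0 ≤ cm) (hm' : cm ≤ cmax)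
    (hu : IsTruncFixed q αp αm cp cm m M k u) (hc : c₀ ≤ cp ∨ c₀ ≤ cm) :
    ∃ u', IsPowSol q αp αm cp cm u u' := by
  have hL : 0 ≤ k ^ 2 - δ := by linarith [H.one_le, H.δ_le_one]
  have hLk : k ^ 2 - δ < k ^ 2 := by linarith [H.δ_pos]
  have hfp := H.isMonoLip_p hp hp'
  have hfm := H.isMonoLip_m hm hm'
  have hlow := H.m_le_of_isTruncFixed hp hp' hm hm' hu hc
  have hhigh := H.le_of_isTruncFixed hp hp' hm hm' hu H.le (hp'.trans H.high_p)
    (hm'.trans H.high_m) le_rfl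
  obtain ⟨u', h1, h2, h3⟩ := hu.exists_hasDerivAt H.k_pos hL hfp hfm
  refine ⟨u', fun x => H.m_pos.trans_le (hlow x), hu.periodic H.k_pos hL hLk hfp hfm,
    hu.reflect H.k_pos hL hLk hfp hfm, h1, h2, fun x hx => (h3 x hx).congr_deriv ?_⟩
  simp only [stepComp, truncLaw_of_mem (hlow x) (hhigh x)]
  split_ifs <;> ring

end Truncation

theorem exists_isPowSol_eq {q αp αm c₀ d₀ d₁ : ℝ} {cp cm : ℝ → ℝ} (hq : 2 < q)
    (hαp : 0 < αp) (hαm : 0 < αm) (hcp : Continuous cp) (hcm : Continuous cm)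
    (hcp0 : ∀ d, 0 ≤ cp d) (hcm0 : ∀ d, 0 ≤ cm d) (hc₀ : 0 < c₀)
    (hmax : ∀ d, c₀ ≤ cp d ∨ c₀ ≤ cm d) (hd₀ : 0 < d₀) (hd : d₀ ≤ d₁)
    (hd₀p : αp * d₀ ^ (2 * q) ≤ cp d₀) (hd₀m : αm * d₀ ^ (2 * q) ≤ cm d₀)
    (hd₁ : ∀ φ φ', IsPowSol q αp αm (cp d₁) (cm d₁) φ φ' →
      (∀ e, 0 < e → αp * e ^ (2 * q) ≤ cp d₁ → αm * e ^ (2 * q) ≤ cm d₁ → ∀ x, e ≤ φ x) →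
      (cp d₁ ≤ αp * d₁ ^ (2 * q) → cm d₁ ≤ αm * d₁ ^ (2 * q) → φ 0 ≤ d₁) → φ 0 ≤ d₁) :
    ∃ d, 0 < d ∧ ∃ φ φ', IsPowSol q αp αm (cp d) (cm d) φ φ' ∧ φ 0 = d := by
  obtain ⟨A, hA⟩ := (isCompact_Icc (a := d₀) (b := d₁)).exists_bound_of_continuousOn
    hcp.continuousOn
  obtain ⟨B, hB⟩ := (isCompact_Icc (a := d₀) (b := d₁)).exists_bound_of_continuousOn
    hcm.continuousOn
  have hA' : ∀ d ∈ Icc d₀ d₁, cp d ≤ max A B := fun d hd =>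
    (le_abs_self _).trans ((hA d hd).trans (le_max_left _ _))
  have hB' : ∀ d ∈ Icc d₀ d₁, cm d ≤ max A B := fun d hd =>
    (le_abs_self _).trans ((hB d hd).trans (le_max_right _ _))
  obtain ⟨m, M, δ, k, H, hmd, hMd⟩ := exists_isTruncation hq hαp hαm hc₀ (max A B) hd₀ d₁
  have hL : 0 ≤ k ^ 2 - δ := by linarith [H.one_le, H.δ_le_one]
  have hLk : k ^ 2 - δ < k ^ 2 := by linarith [H.δ_pos]
  have hex : ∀ d ∈ Icc d₀ d₁, ∃ u, IsTruncFixed q αp αm (cp d) (cm d) m M k u := fun d hd =>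
    exists_isStepFixed H.k_pos hL hLk (H.isMonoLip_p (hcp0 d) (hA' d hd))
      (H.isMonoLip_m (hcm0 d) (hB' d hd))
  choose! u hu using hex
  have hlip : ∀ d ∈ Icc d₀ d₁, ∀ d' ∈ Icc d₀ d₁,
      |u d 0 - u d' 0| ≤ (|cp d - cp d'| + |cm d - cm d'|) * m ^ (-q - 1) / δ :=
      fun d hd d' hd' => by
    have hm1 : 0 < m ^ (-q - 1) := Real.rpow_pos_of_pos H.m_pos _
    have h1 := (hu d hd).abs_sub_le H.k_pos hL hLk (H.isMonoLip_p (hcp0 d) (hA' d hd))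
      (H.isMonoLip_m (hcm0 d) (hB' d hd)) (H.isMonoLip_p (hcp0 d') (hA' d' hd'))
      (H.isMonoLip_m (hcm0 d') (hB' d' hd')) (hu d' hd')
      (ε := (|cp d - cp d'| + |cm d - cm d'|) * m ^ (-q - 1)) (fun x => ?_) (fun x => ?_) 0
    · rwa [sub_sub_cancel] at h1
    · rw [sub_sub_sub_cancel_left, abs_sub_comm]
      refine (abs_truncLaw_sub_le hq H.m_pos _ _ _).trans ?_
      gcongr
      linarith [abs_nonneg (cm d - cm d')]
    · rw [sub_sub_sub_cancel_left, abs_sub_comm]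
      refine (abs_truncLaw_sub_le hq H.m_pos _ _ _).trans ?_
      gcongr
      linarith [abs_nonneg (cp d - cp d')]
  have hcont : ContinuousOn (fun d => u d 0 - d) (Icc d₀ d₁) := by
    refine ContinuousOn.sub (fun d' hd' => ?_) continuousOn_id
    rw [ContinuousWithinAt, tendsto_iff_dist_tendsto_zero]
    refine squeeze_zero' (g := fun d => (|cp d - cp d'| + |cm d - cm d'|) * m ^ (-q - 1) / δ)
      (Eventually.of_forall fun _ => dist_nonneg) ?_ ?_
    · filter_upwards [self_mem_nhdsWithin] with d hd
      exact hlip d hd d' hd'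
    · have : ContinuousAt (fun d => (|cp d - cp d'| + |cm d - cm d'|) * m ^ (-q - 1) / δ) d' := by
        fun_prop
      have h2 := this.tendsto.mono_left (nhdsWithin_le_nhds (s := Icc d₀ d₁))
      simpa using h2
  have hm₀ : d₀ ∈ Icc d₀ d₁ := ⟨le_rfl, hd⟩
  have hm₁ : d₁ ∈ Icc d₀ d₁ := ⟨hd, le_rfl⟩
  have hF₀ : 0 ≤ u d₀ 0 - d₀ := sub_nonneg.2 <|
    H.ge_of_isTruncFixed (hcp0 _) (hA' _ hm₀) (hcm0 _) (hB' _ hm₀) (hu d₀ hm₀) hmd hd₀p hd₀m 0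
  have hF₁ : u d₁ 0 - d₁ ≤ 0 := by
    obtain ⟨φ', hφ'⟩ := H.exists_isPowSol (hcp0 _) (hA' _ hm₁) (hcm0 _) (hB' _ hm₁) (hu d₁ hm₁)
      (hmax d₁)
    refine sub_nonpos.2 (hd₁ (u d₁) φ' hφ' (fun e _ hep hem x => ?_) fun h1 h2 => ?_)
    · rcases le_total m e with h | h
      · exact H.ge_of_isTruncFixed (hcp0 _) (hA' _ hm₁) (hcm0 _) (hB' _ hm₁) (hu d₁ hm₁) h hep hem x
      · exact h.trans (H.m_le_of_isTruncFixed (hcp0 _) (hA' _ hm₁) (hcm0 _) (hB' _ hm₁)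
          (hu d₁ hm₁) (hmax d₁) x)
    · exact H.le_of_isTruncFixed (hcp0 _) (hA' _ hm₁) (hcm0 _) (hB' _ hm₁) (hu d₁ hm₁)
        (hmd.trans hd) h1 h2 hMd 0
  obtain ⟨d, hd', hd0⟩ := intermediate_value_Icc' hd hcont ⟨hF₁, hF₀⟩
  obtain ⟨φ', hφ'⟩ := H.exists_isPowSol (hcp0 _) (hA' _ hd') (hcm0 _) (hB' _ hd') (hu d hd')
    (hmax d)
  exact ⟨d, hd₀.trans_le hd'.1, u d, φ', hφ', sub_eq_zero.1 hd0⟩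

theorem add_sq_le_of_le_deriv {f f' f'' : ℝ → ℝ} {a b h : ℝ} (hf : ∀ x, HasDerivAt f (f' x) x)
    (hf'c : Continuous f') (hb : f' b = 0) (hf' : ∀ x ∈ Ioo a b, HasDerivAt f' (f'' x) x)
    (hh : ∀ x ∈ Ioo a b, h ≤ f'' x) {x : ℝ} (hx : x ∈ Icc a b) :
    f b + h * (b - x) ^ 2 / 2 ≤ f x := by
  have hb' : b ∈ Icc a b := ⟨hx.1.trans hx.2, le_rfl⟩
  have hmono : MonotoneOn (fun x => f' x - h * x) (Icc a b) := by
    refine monotoneOn_of_hasDerivWithinAt_nonneg (f' := fun x => f'' x - h * 1) (convex_Icc a b)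
      (by fun_prop) (fun y hy => ?_) fun y hy => ?_ <;> rw [interior_Icc] at hy
    · exact ((hf' y hy).sub ((hasDerivAt_id y).const_mul h)).hasDerivWithinAt
    · linarith [hh y hy]
  have hanti : AntitoneOn (fun x => f x - h * (b - x) ^ 2 / 2) (Icc a b) := by
    have hd : ∀ y, HasDerivAt (fun x => f x - h * (b - x) ^ 2 / 2) (f' y + h * (b - y)) y :=
      fun y => by
        refine ((hf y).sub (((((hasDerivAt_id y).const_sub b).pow 2).const_mul h).div_const
          2)).congr_deriv ?_
        simp only [id]
        push_cast
        ring
    refine antitoneOn_of_hasDerivWithinAt_nonpos (convex_Icc a b)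
      (fun y _ => (hd y).continuousAt.continuousWithinAt)
      (fun y _ => (hd y).hasDerivWithinAt) fun y hy => ?_
    have h1 := hmono (interior_subset hy) hb' (interior_subset hy).2
    simp only [hb] at h1
    linarith
  have h1 := hanti hx hb' hx.2
  simp only [sub_self] at h1
  linarith

theorem powLaw_mul_self (α c : ℝ) {q u : ℝ} (hq : 2 < q) (hu : 0 < u) :
    2 * q * (powLaw q α c u * u) = α * u ^ q - c / u ^ q := by
  have h1 : u ^ (q - 1) * u = u ^ q := by
    rw [← Real.rpow_add_one hu.ne', sub_add_cancel]
  have h2 : u ^ (-q - 1) * u = (u ^ q)⁻¹ := by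
    rw [← Real.rpow_add_one hu.ne', sub_add_cancel, Real.rpow_neg hu.le]
  rw [powLaw, div_eq_mul_inv c, ← h2, ← h1]
  field_simp

theorem powLaw_energy {q α c a b : ℝ} {φ φ' : ℝ → ℝ} (hab : a < b)
    (hpos : ∀ x, 0 < φ x) (hφ : ∀ x, HasDerivAt φ (φ' x) x) (hφ'c : Continuous φ')
    (hφ' : ∀ x ∈ Ioo a b, HasDerivAt φ' (powLaw q α c (φ x)) x) :
    q ^ 2 * φ' a ^ 2 - α * φ a ^ q - c / φ a ^ q =
      q ^ 2 * φ' b ^ 2 - α * φ b ^ q - c / φ b ^ q := by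
  have hφc : Continuous φ := continuous_iff_continuousAt.2 fun x => (hφ x).continuousAt
  have hpow : ∀ x, 0 < φ x ^ q := fun x => Real.rpow_pos_of_pos (hpos x) q
  have hφq : Continuous fun x => φ x ^ q :=
    hφc.rpow_const fun x => Or.inl (hpos x).ne'
  obtain ⟨x, hx, h⟩ := exists_hasDerivAt_eq_slope
    (fun x => q ^ 2 * φ' x ^ 2 - α * φ x ^ q - c / φ x ^ q) (fun _ => 0) hab
    (Continuous.continuousOn (by
      have := fun x => (hpow x).ne'
      fun_prop (disch := assumption))) fun x hx => by
      have h1 := (hφ x).rpow_const (p := q) (Or.inl (hpos x).ne')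
      refine (((((hφ' x hx).pow 2).const_mul (q ^ 2)).sub (h1.const_mul α)).sub
        ((hasDerivAt_const x c).div h1 (hpow x).ne')).congr_deriv ?_
      have e1 : φ x ^ (q - 1) = φ x ^ q / φ x := Real.rpow_sub_one (hpos x).ne' q
      have e2 : φ x ^ (-q - 1) = (φ x ^ q)⁻¹ / φ x := by
        rw [Real.rpow_sub_one (hpos x).ne', Real.rpow_neg (hpos x).le]
      rw [powLaw, e1, e2]
      have := (hpow x).ne'
      have := (hpos x).ne'
      field_simp
      ring
  rw [eq_div_iff (sub_pos.2 hab).ne', zero_mul] at h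
  linarith

section Estimate

variable {q αp αm cp cm : ℝ} {φ φ' : ℝ → ℝ}

theorem IsPowSol.deriv_pi_sub (H : IsPowSol q αp αm cp cm φ φ') (x : ℝ) : φ' (π - x) = -φ' x := by
  have h1 : HasDerivAt (fun x => φ (π - x)) (-φ' (π - x)) x := by
    simpa using (H.hasDerivAt (π - x)).comp_const_sub π x
  rw [funext H.reflect] at h1
  linarith [h1.unique (H.hasDerivAt x)]

theorem IsPowSol.deriv_pi_div_two (H : IsPowSol q αp αm cp cm φ φ') : φ' (π / 2) = 0 := by
  have h := H.deriv_pi_sub (π / 2)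
  rw [sub_half] at h
  linarith

theorem IsPowSol.deriv_neg_pi_div_two (H : IsPowSol q αp αm cp cm φ φ') : φ' (-(π / 2)) = 0 := by
  have h := H.deriv_pi_sub (-(π / 2))
  have h1 : HasDerivAt (fun x => φ (x + 2 * π)) (φ' (-(π / 2) + 2 * π)) (-(π / 2)) :=
    (H.hasDerivAt _).comp_add_const _ _
  rw [funext H.periodic] at h1
  have h2 := h1.unique (H.hasDerivAt _)
  rw [show π - -(π / 2) = -(π / 2) + 2 * π by ring] at h
  linarith

theorem IsPowSol.sq_sub_le {ap am bp bm : ℝ} (hq : 2 < q) (hap : 0 < ap) (hbp : 0 ≤ bp)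
    (H : IsPowSol q (ap ^ 2) (am ^ 2) (bp ^ 2) (bm ^ 2) φ φ') (hle : ∀ x, bp ≤ ap * φ x ^ q) :
    (ap * φ 0 ^ q - bp) ^ 2 ≤ (am * φ 0 ^ q - bm) ^ 2 + 2 * q * φ 0 ^ 2 * φ 0 ^ q := by
  have hpi := Real.pi_pos
  have hpow : ∀ x, 0 < φ x ^ q := fun x => Real.rpow_pos_of_pos (H.pos x) q
  have hdp : ∀ x ∈ Ioo 0 (π / 2), HasDerivAt φ' (powLaw q (ap ^ 2) (bp ^ 2) (φ x)) x :=
    fun x hx => by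
      have hs := Real.sin_pos_of_pos_of_lt_pi hx.1 (by linarith [hx.2])
      simpa [hs] using H.hasDerivAt_deriv x hs.ne'
  have hdm : ∀ x ∈ Ioo (-(π / 2)) 0, HasDerivAt φ' (powLaw q (am ^ 2) (bm ^ 2) (φ x)) x :=
    fun x hx => by
      have hs := Real.sin_neg_of_neg_of_neg_pi_lt hx.2 (by linarith [hx.1])
      simpa [hs.not_gt] using H.hasDerivAt_deriv x hs.ne
  have hmin : ∀ x ∈ Icc 0 (π / 2), φ (π / 2) ≤ φ x := fun x hx => by
    have := add_sq_le_of_le_deriv (h := 0) H.hasDerivAt H.continuous_deriv H.deriv_pi_div_two hdp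
      (fun y _ => ?_) hx
    · linarith
    · refine powLaw_nonneg hq (H.pos y) ?_
      rw [mul_comm 2 q, Real.rpow_mul (H.pos y).le, Real.rpow_two, ← mul_pow]
      exact pow_le_pow_left₀ hbp (hle y) 2
  have h0 : (0 : ℝ) ∈ Icc 0 (π / 2) := ⟨le_rfl, by linarith⟩
  have hquad := add_sq_le_of_le_deriv (h := powLaw q (ap ^ 2) (bp ^ 2) (φ (π / 2))) H.hasDerivAt
    H.continuous_deriv H.deriv_pi_div_two hdp (fun y hy =>
      powLaw_mono hq (by positivity) (by positivity) (H.pos _) (hmin y (Ioo_subset_Icc_self hy))) h0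
  have hE₁ := powLaw_energy (by linarith) H.pos H.hasDerivAt H.continuous_deriv hdp
  have hE₂ := powLaw_energy (by linarith) H.pos H.hasDerivAt H.continuous_deriv hdm
  rw [H.deriv_pi_div_two] at hE₁
  rw [H.deriv_neg_pi_div_two] at hE₂
  have hlaw := powLaw_mul_self (ap ^ 2) (bp ^ 2) hq (H.pos (π / 2))
  have hφ₀ := H.pos 0
  have hφ₁ := H.pos (π / 2)
  have hm := hmin 0 h0
  have hle₁ := hle (π / 2)
  set P := powLaw q (ap ^ 2) (bp ^ 2) (φ (π / 2))
  have hPle : P * φ (π / 2) ≤ φ 0 ^ 2 := by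
    have : P ≤ φ 0 ∨ P ≤ 0 := by
      rcases le_total P 0 with h | h
      · exact Or.inr h
      · left
        nlinarith [Real.pi_gt_three, mul_le_mul_of_nonneg_left
          (by nlinarith [Real.pi_gt_three] : 8 ≤ π ^ 2) h]
    rcases this with h | h <;> nlinarith
  have hs₀ := hpow 0
  have hs₁ := hpow (π / 2)
  have hs₂ := hpow (-(π / 2))
  generalize φ 0 ^ q = s₀ at *
  generalize φ (π / 2) ^ q = s₁ at *
  generalize φ (-(π / 2)) ^ q = s₂ at *
  have hr : ap ^ 2 * s₁ + bp ^ 2 / s₁ - 2 * ap * bp ≤ 2 * q * φ 0 ^ 2 := by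
    calc _ = (ap * s₁ - bp) ^ 2 / s₁ := by
          field_simp
          ring
      _ ≤ ((ap * s₁) ^ 2 - bp ^ 2) / s₁ := by
          gcongr
          nlinarith
      _ = 2 * q * (P * φ (π / 2)) := by
          rw [hlaw]
          field_simp
      _ ≤ _ := by nlinarith
  have hm₂ : 2 * am * bm ≤ am ^ 2 * s₂ + bm ^ 2 / s₂ := by
    have : am ^ 2 * s₂ + bm ^ 2 / s₂ - 2 * am * bm = (am * s₂ - bm) ^ 2 / s₂ := by
      field_simp
      ring
    linarith [show 0 ≤ (am * s₂ - bm) ^ 2 / s₂ by positivity]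
  have hfin : ap ^ 2 * s₀ + bp ^ 2 / s₀ - 2 * ap * bp ≤
      am ^ 2 * s₀ + bm ^ 2 / s₀ - 2 * am * bm + 2 * q * φ 0 ^ 2 := by linarith
  have := mul_le_mul_of_nonneg_right hfin hs₀.le
  have e₁ : bp ^ 2 / s₀ * s₀ = bp ^ 2 := div_mul_cancel₀ _ hs₀.ne'
  have e₂ : bm ^ 2 / s₀ * s₀ = bm ^ 2 := div_mul_cancel₀ _ hs₀.ne'
  nlinarith

end Estimate
theorem IsPowSol.apply_zero_le {q t γ μ β d : ℝ} {φ φ' : ℝ → ℝ} (hq : 2 < q) (htγ : 2 < t - γ)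
    (hγ : |γ| < 1) (hβ : 0 ≤ β) (hd : 0 < d) (h₁ : |μ| + √β ≤ d ^ q * (t - γ))
    (h₂ : 2 * (|μ| + √β) ≤ d ^ q * (t - 1)) (h₃ : 2 * (|μ| + √β) ≤ d ^ q * (1 - |γ|))
    (h₄ : 2 * q < (t - 1) * (1 - |γ|) * d ^ (q - 2))
    (H : IsPowSol q ((t + 1) ^ 2) ((t - 1) ^ 2) (β + (μ + d ^ q * (γ + 1)) ^ 2)
      (β + (μ + d ^ q * (γ - 1)) ^ 2) φ φ')
    (hlow : ∀ e, 0 < e → (t + 1) ^ 2 * e ^ (2 * q) ≤ β + (μ + d ^ q * (γ + 1)) ^ 2 →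
      (t - 1) ^ 2 * e ^ (2 * q) ≤ β + (μ + d ^ q * (γ - 1)) ^ 2 → ∀ x, e ≤ φ x)
    (hhigh : β + (μ + d ^ q * (γ + 1)) ^ 2 ≤ (t + 1) ^ 2 * d ^ (2 * q) →
      β + (μ + d ^ q * (γ - 1)) ^ 2 ≤ (t - 1) ^ 2 * d ^ (2 * q) → φ 0 ≤ d) :
    φ 0 ≤ d := by
  by_contra! hlt
  have hγ' := abs_lt.1 hγ
  have ht : 1 < t := by linarith
  have hq0 : q ≠ 0 := by linarith
  have hD : 0 < d ^ q := Real.rpow_pos_of_pos hd q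
  have hsq : ∀ e : ℝ, 0 < e → e ^ (2 * q) = (e ^ q) ^ 2 := fun e he => by
    rw [mul_comm 2 q, Real.rpow_mul he.le, Real.rpow_two]
  have hnn : ∀ y : ℝ, 0 ≤ β + (μ + y) ^ 2 := fun y => by positivity
  have hub : ∀ y : ℝ, √(β + (μ + y) ^ 2) ≤ |y| + (|μ| + √β) := fun y => by
    rw [Real.sqrt_le_left (by positivity)]
    nlinarith [Real.sq_sqrt hβ, Real.sqrt_nonneg β, abs_add_le μ y, sq_abs (μ + y),
      abs_nonneg (μ + y), abs_nonneg μ, abs_nonneg y]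
  have hlb : ∀ y : ℝ, |y| - |μ| ≤ √(β + (μ + y) ^ 2) := fun y => by
    have h1 := Real.abs_le_sqrt (show (μ + y) ^ 2 ≤ β + (μ + y) ^ 2 by linarith)
    have h2 := abs_sub_abs_le_abs_sub y (-μ)
    rw [abs_neg, sub_neg_eq_add, add_comm y] at h2
    exact h2.trans h1
  set D := d ^ q with hDdef
  have hubp := hub (D * (γ + 1))
  have hubm := hub (D * (γ - 1))
  have hlbm := hlb (D * (γ - 1))
  have hcp := Real.sq_sqrt (hnn (D * (γ + 1)))
  have hcm := Real.sq_sqrt (hnn (D * (γ - 1)))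
  have hbp := Real.sqrt_nonneg (β + (μ + D * (γ + 1)) ^ 2)
  have hbm := Real.sqrt_nonneg (β + (μ + D * (γ - 1)) ^ 2)
  rw [abs_of_nonneg (by nlinarith)] at hubp
  rw [abs_of_nonpos (by nlinarith)] at hubm hlbm
  rw [← hcp] at hlow hhigh H
  rw [← hcm] at hlow hhigh H
  set bp := √(β + (μ + D * (γ + 1)) ^ 2)
  set bm := √(β + (μ + D * (γ - 1)) ^ 2)
  have hβ' := Real.sqrt_nonneg β
  have hbpD : bp ≤ (t + 1) * D := by linarith
  have hbmD : (t - 1) * D < bm := by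
    by_contra! h
    refine hlt.not_ge (hhigh ?_ ?_) <;> rw [hsq d hd, ← mul_pow]
    · exact pow_le_pow_left₀ hbp hbpD 2
    · exact pow_le_pow_left₀ hbm h 2
  have hle : ∀ x, bp ≤ (t + 1) * φ x ^ q := fun x => by
    rcases hbp.eq_or_lt with h | h
    · rw [← h]
      have := Real.rpow_pos_of_pos (H.pos x) q
      positivity
    have he : 0 < bp / (t + 1) := div_pos h (by linarith)
    have heq : ((bp / (t + 1)) ^ q⁻¹) ^ q = bp / (t + 1) := Real.rpow_inv_rpow he.le hq0
    have he0 : 0 < (bp / (t + 1)) ^ q⁻¹ := Real.rpow_pos_of_pos he _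
    have h1 : bp / (t + 1) * (t + 1) = bp := div_mul_cancel₀ _ (by linarith)
    have h2 : bp / (t + 1) ≤ D := by
      rw [div_le_iff₀ (by linarith)]
      linarith
    have h3 := hlow _ he0 (by rw [hsq _ he0, heq, ← mul_pow, mul_comm, h1]) (by
      rw [hsq _ he0, heq, ← mul_pow]
      refine pow_le_pow_left₀ (by nlinarith) (le_trans ?_ hbmD.le) 2
      exact mul_le_mul_of_nonneg_left h2 (by linarith)) x
    have h4 := Real.rpow_le_rpow he0.le h3 (by linarith : 0 ≤ q)
    rw [heq] at h4
    rwa [div_le_iff₀' (by linarith)] at h4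
  have hmain := H.sq_sub_le hq (by linarith) hbp hle
  have hφ₀ := H.pos 0
  have hDs : D ≤ φ 0 ^ q := Real.rpow_le_rpow hd.le hlt.le (by linarith)
  have hs : φ 0 ^ q = φ 0 ^ (q - 2) * φ 0 ^ 2 := by
    rw [← Real.rpow_two, ← Real.rpow_add hφ₀, sub_add_cancel]
  have hmono : d ^ (q - 2) ≤ φ 0 ^ (q - 2) := Real.rpow_le_rpow hd.le hlt.le (by linarith)
  have hγ₁ : 0 < 1 - |γ| := by linarith
  have hs₀ : 0 < φ 0 ^ q := hD.trans_le hDs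
  have hf₁ : (t - 1) * φ 0 ^ q ≤ 2 * t * φ 0 ^ q - bp - bm := by
    linarith [mul_le_mul_of_nonneg_left hDs (by linarith : 0 ≤ t - 1)]
  have hf₂ : (1 - |γ|) * φ 0 ^ q ≤ 2 * φ 0 ^ q - bp + bm := by
    linarith [mul_le_mul_of_nonneg_left (le_abs_self γ) hD.le,
      mul_le_mul_of_nonneg_left hDs hγ₁.le, mul_nonneg (abs_nonneg γ) (sub_nonneg.2 hDs)]
  have hprod := mul_le_mul hf₁ hf₂ (by positivity)
    ((mul_pos (by linarith) hs₀).le.trans hf₁)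
  have hfin : (t - 1) * (1 - |γ|) * φ 0 ^ q ≤ 2 * q * φ 0 ^ 2 := by
    refine le_of_mul_le_mul_right ?_ hs₀
    linarith
  rw [hs, ← mul_assoc] at hfin
  have h5 := le_of_mul_le_mul_right hfin (by positivity)
  have h6 := mul_le_mul_of_nonneg_left hmono (mul_pos (by linarith : 0 < t - 1) hγ₁).le
  linarith
theorem two_lt_qex {n : ℕ} (hn : 3 ≤ n) : 2 < qex n := by
  have : (3 : ℝ) ≤ n := by exact_mod_cast hn
  rw [qex, lt_div_iff₀ (by linarith)]
  linarith

theorem kap_pos {n : ℕ} (hn : 3 ≤ n) : 0 < kap n := by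
  have : (3 : ℝ) ≤ n := by exact_mod_cast hn
  exact div_pos (by linarith) (by linarith)

theorem IsPowSol.isModelSolution {n : ℕ} (hn : 3 ≤ n) {t γ η μ d : ℝ} {φ φ' : ℝ → ℝ} (hd : 0 < d)
    (H : IsPowSol (qex n) ((t + 1) ^ 2) ((t - 1) ^ 2)
      (2 * η ^ 2 / kap n + (μ + d ^ qex n * (γ + 1)) ^ 2)
      (2 * η ^ 2 / kap n + (μ + d ^ qex n * (γ - 1)) ^ 2) φ φ') :
    IsModelSolution n t γ η μ d fun x => φ x / d := by
  have hder : ∀ x, HasDerivAt (fun x => φ x / d) (φ' x / d) x := fun x =>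
    (H.hasDerivAt x).div_const d
  have hderiv : deriv (fun x => φ x / d) = fun x => φ' x / d := funext fun x => (hder x).deriv
  refine ⟨fun x => by simp only [H.periodic], fun x => div_pos (H.pos x) hd, ?_, fun x hx => ?_⟩
  · rw [contDiff_one_iff_deriv, hderiv]
    exact ⟨fun x => (hder x).differentiableAt, H.continuous_deriv.div_const d⟩
  have hsin : Real.sin x ≠ 0 := fun h => by
    obtain ⟨k, hk⟩ := Real.sin_eq_zero_iff.1 h
    exact hx k hk.symm
  have hder₂ : HasDerivAt (fun x => φ' x / d) (powLaw (qex n) ((t + lam x) ^ 2)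
      (2 * η ^ 2 / kap n + (μ + d ^ qex n * (γ + lam x)) ^ 2) (φ x) / d) x := by
    refine ((H.hasDerivAt_deriv x hsin).congr_deriv ?_).div_const d
    unfold lam
    split_ifs <;> simp [sub_eq_add_neg]
  rw [hderiv]
  refine ⟨hder₂.differentiableAt, ?_⟩
  rw [hder₂.deriv]
  have hφ := H.pos x
  have hq := two_lt_qex hn
  have hκ := kap_pos hn
  have e₁ : d ^ (-(qex n - 2)) = d ^ 2 / d ^ qex n := by
    rw [neg_sub, Real.rpow_sub hd, Real.rpow_two]
  have e₂ : d ^ (-(2 * qex n)) = ((d ^ qex n) ^ 2)⁻¹ := by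
    rw [Real.rpow_neg hd.le, mul_comm, Real.rpow_mul hd.le, Real.rpow_two]
  have e₃ : d ^ (-qex n) = (d ^ qex n)⁻¹ := Real.rpow_neg hd.le _
  have e₄ : ∀ u : ℝ, 0 < u → u ^ (-qex n - 1) = (u ^ qex n)⁻¹ / u := fun u hu => by
    rw [Real.rpow_sub_one hu.ne', Real.rpow_neg hu.le]
  have e₅ : ∀ u : ℝ, 0 < u → u ^ (qex n - 1) = u ^ qex n / u := fun u hu =>
    Real.rpow_sub_one hu.ne' _
  rw [powLaw, e₁, e₂, e₃, e₄ _ hφ, e₅ _ hφ, e₄ _ (div_pos hφ hd), e₅ _ (div_pos hφ hd),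
    Real.div_rpow hφ.le hd.le]
  have hS : 0 < φ x ^ qex n := Real.rpow_pos_of_pos hφ _
  have hD : 0 < d ^ qex n := Real.rpow_pos_of_pos hd _
  generalize φ x ^ qex n = S at *
  generalize d ^ qex n = D at *
  field_simp
  ring

theorem exists_isModelSolution_of_two_lt {n : ℕ} (hn : 3 ≤ n) {t γ η μ : ℝ} (hγ : |γ| < 1)
    (htγ : 2 < t - γ) (hημ : η ≠ 0 ∨ μ ≠ 0) :
    ∃ d : ℝ, 0 < d ∧ ∃ ψ : ℝ → ℝ, IsModelSolution n t γ η μ d ψ ∧ ψ 0 = 1 := by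
  have hq := two_lt_qex hn
  have hκ := kap_pos hn
  have hγ' := abs_lt.1 hγ
  have ht : 1 < t := by linarith
  set q := qex n with hqdef
  set β := 2 * η ^ 2 / kap n with hβdef
  have hβ : 0 ≤ β := by positivity
  have hβμ : 0 < β + μ ^ 2 := by
    rcases hημ with h | h
    · have : 0 < β := by positivity
      positivity
    · positivity
  have hpow := Real.continuous_rpow_const (q := q) (by linarith)
  have hpow₂ := Real.continuous_rpow_const (q := 2 * q) (by linarith)
  have hsmall : ∀ s : ℝ, ∀ᶠ d in 𝓝[>] (0 : ℝ),
      (t + s) ^ 2 * d ^ (2 * q) < β + (μ + d ^ q * (γ + s)) ^ 2 := fun s => by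
    have h1 : ContinuousAt (fun d : ℝ => (t + s) ^ 2 * d ^ (2 * q)) 0 := by fun_prop
    have h2 : ContinuousAt (fun d : ℝ => β + (μ + d ^ q * (γ + s)) ^ 2) 0 := by fun_prop
    refine mem_nhdsWithin_of_mem_nhds (h1.eventually_lt h2 ?_)
    simpa [Real.zero_rpow (by linarith : q ≠ 0), Real.zero_rpow (by linarith : 2 * q ≠ 0)]
  have hlarge : ∀ p a c : ℝ, 0 < p → 0 < a → ∀ᶠ d in atTop, c < d ^ p * a := fun p a c hp ha =>
    ((tendsto_rpow_atTop hp).atTop_mul_const ha).eventually_gt_atTop c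
  obtain ⟨d₀, hd₀p, hd₀m, hd₀⟩ := ((hsmall 1).and ((hsmall (-1)).and
    (self_mem_nhdsWithin (a := (0 : ℝ)) (s := Ioi 0)))).exists
  have hd₀ : 0 < d₀ := hd₀
  have hγ₁ : 0 < 1 - |γ| := by linarith
  have ht₁ : 0 < t - 1 := by linarith
  obtain ⟨d₁, hd, h₁, h₂, h₃, h₄⟩ := ((eventually_ge_atTop d₀).and
    ((hlarge q (t - γ) (|μ| + √β) (by linarith) (by linarith)).and
    ((hlarge q (t - 1) (2 * (|μ| + √β)) (by linarith) ht₁).and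
    ((hlarge q (1 - |γ|) (2 * (|μ| + √β)) (by linarith) hγ₁).and
    (hlarge (q - 2) ((t - 1) * (1 - |γ|)) (2 * q) (by linarith) (by positivity)))))).exists
  have hmax : ∀ d : ℝ, (β + μ ^ 2) / 2 ≤ β + (μ + d ^ q * (γ + 1)) ^ 2 ∨
      (β + μ ^ 2) / 2 ≤ β + (μ + d ^ q * (γ - 1)) ^ 2 := fun d => by
    by_contra! h
    have hγ₂ : γ ^ 2 ≤ 1 := (sq_le_one_iff_abs_le_one γ).2 hγ.le
    nlinarith [sq_nonneg (μ + 2 * (d ^ q * γ)), sq_nonneg (d ^ q),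
      mul_nonneg (sq_nonneg (d ^ q)) (sub_nonneg.2 hγ₂)]
  obtain ⟨d, hd0, φ, φ', H, hφ⟩ := exists_isPowSol_eq (q := q) (αp := (t + 1) ^ 2)
    (αm := (t - 1) ^ 2) (c₀ := (β + μ ^ 2) / 2) (d₀ := d₀) (d₁ := d₁)
    (cp := fun d => β + (μ + d ^ q * (γ + 1)) ^ 2) (cm := fun d => β + (μ + d ^ q * (γ - 1)) ^ 2)
    hq (by positivity) (by positivity) (by fun_prop) (by fun_prop) (fun d => by positivity)
    (fun d => by positivity) (by positivity) hmax hd₀ hd hd₀p.le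
    (by simpa only [← sub_eq_add_neg] using hd₀m.le) fun φ φ' H hlow hhigh =>
      H.apply_zero_le hq htγ hγ hβ (hd₀.trans_le hd) h₁.le h₂.le h₃.le
        (by linarith) hlow hhigh
  exact ⟨d, hd0, _, H.isModelSolution hn hd0, by simp only [hφ, div_self hd0.ne']⟩

theorem IsModelSolution.comp_neg {n : ℕ} {t γ η μ d : ℝ} {ψ : ℝ → ℝ}
    (H : IsModelSolution n (-t) (-γ) η (-μ) d ψ) :
    IsModelSolution n t γ η μ d fun x => ψ (-x) := by
  obtain ⟨h₁, h₂, h₃, h₄⟩ := H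
  have hderiv : deriv (fun x => ψ (-x)) = fun x => -deriv ψ (-x) :=
    funext fun x => deriv_comp_neg ψ x
  refine ⟨fun x => ?_, fun x => h₂ _, h₃.comp contDiff_neg, fun x hx => ?_⟩
  · simp only [← h₁ (-(x + 2 * π))]
    ring_nf
  have hsin : Real.sin x ≠ 0 := fun h => by
    obtain ⟨k, hk⟩ := Real.sin_eq_zero_iff.1 h
    exact hx k hk.symm
  have hlam : lam (-x) = -lam x := by
    unfold lam
    rw [Real.sin_neg]
    rcases hsin.lt_or_gt with h | h
    · simp [h, h.not_gt]
    · simp [h, h.le]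
  obtain ⟨h₅, h₆⟩ := h₄ (-x) fun k hk => hx (-k) (by push_cast; linarith)
  have h₇ : HasDerivAt (fun x => -deriv ψ (-x)) (deriv (deriv ψ) (-x)) x := by
    refine (h₅.hasDerivAt.comp x (hasDerivAt_neg x)).neg.congr_deriv ?_
    ring
  rw [hderiv]
  refine ⟨h₇.differentiableAt, ?_⟩
  rw [h₇.deriv, ← h₆, hlam]
  ring

end Existence

/-- Near-CMC existence (Theorem 3.3, existence part). -/
theorem near_cmc_existence (n : ℕ) (hn : 3 ≤ n) (t γ η μ : ℝ)
    (hγ : -1 < γ ∧ γ < 1) (ht : |t - γ| > 2) (hTT : η ≠ 0 ∨ μ ≠ 0) :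
    ∃ d : ℝ, 0 < d ∧ ∃ ψ : ℝ → ℝ, IsModelSolution n t γ η μ d ψ ∧ ψ 0 = 1 := by
  have hγ' : |γ| < 1 := abs_lt.2 hγ
  rcases lt_abs.1 ht with h | h
  · exact exists_isModelSolution_of_two_lt hn hγ' h hTT
  · obtain ⟨d, hd, ψ, hψ, hψ₀⟩ := exists_isModelSolution_of_two_lt hn (t := -t) (γ := -γ)
      (η := η) (μ := -μ) (by rwa [abs_neg]) (by linarith) (by simpa using hTT)
    exact ⟨d, hd, _, hψ.comp_neg, by simpa using hψ₀⟩
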